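/- arXiv:0805.3788 — 5 statements merged into one kernel-verified Lean document; each statement's English description precedes it below -/
import Mathlib

section
/- Let R be a noetherian local domain with maximal ideal m_R and let ν be a valuation of the fraction field of R with values in the ordered group (ℝ,+) that dominates R (i.e. ν(x) ≥ 0 for all x ∈ R∖{0} and ν(x) > 0 for all x ∈ m_R∖{0}). Assume ν(R∖{0}) is a well-ordered subset of ℝ, and let t₁ = min{ν(f) : f ∈ m_R∖{0}}. Then for every integer y ≥ 1 the set S^R(ν) ∩ [0, y·t₁) is finite and its cardinality is strictly less than the length of the R-module R/m_R^y. -/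
/-- The length of a module, i.e. the supremum of lengths of chains of submodules,
realized as the Krull dimension of the lattice of submodules. -/
noncomputable def moduleLength (R M : Type*) [Ring R] [AddCommGroup M] [Module R M] :
    WithBot ℕ∞ :=
  Order.krullDim (Submodule R M)

/-- A strictly antitone family indexed by a finite linearly ordered set bounds the Krull dimension
of its codomain from below. -/
lemma Finset.card_le_krullDim_add_one {α β : Type*} [LinearOrder α] [Preorder β] (t : Finset α)
    (ht : t.Nonempty) (f : α → β) (hf : StrictAntiOn f t) :
    (t.card : WithBot ℕ∞) ≤ Order.krullDim β + 1 := by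
  obtain ⟨n, hn⟩ := Nat.exists_eq_succ_of_ne_zero ht.card_ne_zero
  let s : LTSeries β := LTSeries.mk n (fun i => f (t.orderEmbOfFin hn i.rev)) fun i j hij =>
    hf (t.orderEmbOfFin_mem hn _) (t.orderEmbOfFin_mem hn _)
      ((t.orderEmbOfFin hn).strictMono (Fin.rev_lt_rev.mpr hij))
  rw [hn, Nat.succ_eq_add_one, Nat.cast_add, Nat.cast_one]
  gcongr
  exact Order.LTSeries.length_le_krullDim s

lemma IsLocalRing.isFiniteLength_quotient_maximalIdeal_pow (R : Type*) [CommRing R]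
    [IsNoetherianRing R] [IsLocalRing R] (n : ℕ) :
    IsFiniteLength R (R ⧸ IsLocalRing.maximalIdeal R ^ n) := by
  rcases eq_or_ne n 0 with rfl | hn
  · rw [pow_zero, Ideal.one_eq_top]
    have : Subsingleton (R ⧸ (⊤ : Ideal R)) := Ideal.Quotient.subsingleton_iff.mpr rfl
    exact .of_subsingleton
  have : IsArtinianRing (R ⧸ IsLocalRing.maximalIdeal R ^ n) :=
    IsLocalRing.quotient_artinian_of_mem_minimalPrimes_of_isLocalRing _
      ⟨⟨inferInstance, Ideal.pow_le_self hn⟩, fun _ hq _ => hq.1.le_of_pow_le hq.2⟩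
  exact isFiniteLength_iff_isNoetherian_isArtinian.mpr
    ⟨isNoetherian_quotient _,
      isArtinian_of_surjective_algebraMap
        (Ideal.Quotient.mk_surjective (I := IsLocalRing.maximalIdeal R ^ n))⟩

/-- The ideal of elements of value at least `φ`. -/
def valueIdeal {R : Type*} [CommRing R] [IsDomain R] (v : R → ℝ)
    (hmul : ∀ x y : R, x ≠ 0 → y ≠ 0 → v (x * y) = v x + v y)
    (hadd : ∀ x y : R, x ≠ 0 → y ≠ 0 → x + y ≠ 0 → min (v x) (v y) ≤ v (x + y))
    (hnonneg : ∀ x : R, x ≠ 0 → 0 ≤ v x) (φ : ℝ) : Ideal R where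
  carrier := {x | x ≠ 0 → φ ≤ v x}
  zero_mem' h := absurd rfl h
  add_mem' {x y} hx hy hxy := by
    rcases eq_or_ne x 0 with rfl | hx0
    · simpa using hy (by simpa using hxy)
    rcases eq_or_ne y 0 with rfl | hy0
    · simpa using hx hx0
    exact (le_min (hx hx0) (hy hy0)).trans (hadd x y hx0 hy0 hxy)
  smul_mem' c x hx hcx := by
    obtain ⟨hc0, hx0⟩ := mul_ne_zero_iff.mp hcx
    rw [smul_eq_mul, hmul c x hc0 hx0]
    linarith [hx hx0, hnonneg c hc0]

section valueIdeal

variable {R : Type*} [CommRing R] [IsDomain R] (v : R → ℝ)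
  (hmul : ∀ x y : R, x ≠ 0 → y ≠ 0 → v (x * y) = v x + v y)
  (hadd : ∀ x y : R, x ≠ 0 → y ≠ 0 → x + y ≠ 0 → min (v x) (v y) ≤ v (x + y))
  (hnonneg : ∀ x : R, x ≠ 0 → 0 ≤ v x)

lemma mem_valueIdeal {φ : ℝ} {x : R} :
    x ∈ valueIdeal v hmul hadd hnonneg φ ↔ (x ≠ 0 → φ ≤ v x) := Iff.rfl

lemma valueIdeal_mul_le (φ ψ : ℝ) :
    valueIdeal v hmul hadd hnonneg φ * valueIdeal v hmul hadd hnonneg ψ ≤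
      valueIdeal v hmul hadd hnonneg (φ + ψ) := by
  refine Ideal.mul_le.mpr fun x hx y hy hxy => ?_
  obtain ⟨hx0, hy0⟩ := mul_ne_zero_iff.mp hxy
  rw [hmul x y hx0 hy0]
  exact add_le_add (hx hx0) (hy hy0)

lemma pow_le_valueIdeal {I : Ideal R} {φ : ℝ} (hI : I ≤ valueIdeal v hmul hadd hnonneg φ) (n : ℕ) :
    I ^ n ≤ valueIdeal v hmul hadd hnonneg (n * φ) := by
  induction n with
  | zero => exact fun x _ hx => by simpa using hnonneg x hx
  | succ n ih =>
    rw [pow_succ, Nat.cast_succ, add_one_mul]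
    exact (Ideal.mul_mono ih hI).trans (valueIdeal_mul_le ..)

lemma valueIdeal_lt_of_lt {φ ψ : ℝ} (h : φ < ψ) (hφ : ∃ x : R, x ≠ 0 ∧ v x = φ) :
    valueIdeal v hmul hadd hnonneg ψ < valueIdeal v hmul hadd hnonneg φ := by
  refine SetLike.lt_iff_le_and_exists.mpr ⟨fun x hx h0 => h.le.trans (hx h0), ?_⟩
  obtain ⟨x, hx0, rfl⟩ := hφ
  exact ⟨x, fun _ => le_rfl, fun hx => (hx hx0).not_gt h⟩

end valueIdeal

/-- A finite set of values, all smaller than a lower bound `ψ` for the values on `I`, has at most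
as many elements as the length of `R ⧸ I`. -/
lemma card_le_length_quotient {R : Type*} [CommRing R] [IsDomain R] (v : R → ℝ)
    (hmul : ∀ x y : R, x ≠ 0 → y ≠ 0 → v (x * y) = v x + v y)
    (hadd : ∀ x y : R, x ≠ 0 → y ≠ 0 → x + y ≠ 0 → min (v x) (v y) ≤ v (x + y))
    (hnonneg : ∀ x : R, x ≠ 0 → 0 ≤ v x) {I : Ideal R} {ψ : ℝ}
    (hI : I ≤ valueIdeal v hmul hadd hnonneg ψ) (t : Finset ℝ)
    (ht : ∀ r ∈ t, (∃ x : R, x ≠ 0 ∧ v x = r) ∧ r < ψ) :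
    (t.card : ℕ∞) ≤ Module.length R (R ⧸ I) := by
  have hψ : ψ ∉ t := fun h => (ht ψ h).2.false
  have hle : ∀ r ∈ insert ψ t, r ≤ ψ := by
    intro r hr
    rcases Finset.mem_insert.mp hr with rfl | hr
    exacts [le_rfl, (ht r hr).2.le]
  let f : ℝ → Set.Ici I := fun r =>
    ⟨I ⊔ valueIdeal v hmul hadd hnonneg r, Set.mem_Ici.mpr le_sup_left⟩
  have hf : StrictAntiOn f (insert ψ t : Finset ℝ) := by
    intro a ha b hb hab
    have hIle : ∀ r ∈ insert ψ t, I ≤ valueIdeal v hmul hadd hnonneg r := fun r hr =>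
      hI.trans fun x hx h0 => (hle r hr).trans (hx h0)
    have hat : a ∈ t := Finset.mem_of_mem_insert_of_ne ha (hab.trans_le (hle b hb)).ne
    change I ⊔ _ < I ⊔ _
    rw [sup_eq_right.mpr (hIle a ha), sup_eq_right.mpr (hIle b hb)]
    exact valueIdeal_lt_of_lt v hmul hadd hnonneg hab (ht a hat).1
  have key := Finset.card_le_krullDim_add_one _ (Finset.insert_nonempty ψ t) f hf
  rw [Finset.card_insert_of_notMem hψ, ← Order.coheight_eq_krullDim_Ici,
    ← Module.length_quotient] at key
  have key' : (t.card : ℕ∞) + 1 ≤ Module.length R (R ⧸ I) + 1 := by exact_mod_cast key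
  exact (ENat.add_le_add_iff_right ENat.one_ne_top).mp key'

/-- Let `R` be a noetherian local domain with maximal ideal `m_R`, and `ν` a
real-valued (additive) valuation of the fraction field `K` of `R` dominating `R`.  Assume
`ν(R∖{0})` is well ordered, and let `t₁` be the minimum of `ν` on `m_R∖{0}`.  Then for every
`y ≥ 1` the set `S^R(ν) ∩ [0, y·t₁)` is finite of cardinality strictly less than the length of
the `R`-module `R/m_R^y`. -/
theorem stmt0 (R : Type*) [CommRing R] [IsDomain R] [IsNoetherianRing R] [IsLocalRing R]
    (K : Type*) [Field K] [Algebra R K] [IsFractionRing R K]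
    (ν : K → ℝ)
    (hmul : ∀ x y : K, x ≠ 0 → y ≠ 0 → ν (x * y) = ν x + ν y)
    (hadd : ∀ x y : K, x ≠ 0 → y ≠ 0 → x + y ≠ 0 → min (ν x) (ν y) ≤ ν (x + y))
    (hnonneg : ∀ x : R, x ≠ 0 → 0 ≤ ν (algebraMap R K x))
    (hdom : ∀ x : R, x ∈ IsLocalRing.maximalIdeal R → x ≠ 0 → 0 < ν (algebraMap R K x))
    (hWF : Set.IsWF {r : ℝ | ∃ x : R, x ≠ 0 ∧ ν (algebraMap R K x) = r})
    (t₁ : ℝ)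
    (ht₁ : IsLeast {r : ℝ | ∃ x : R, x ∈ IsLocalRing.maximalIdeal R ∧ x ≠ 0 ∧
      ν (algebraMap R K x) = r} t₁)
    (y : ℕ) (hy : 1 ≤ y) :
    {r : ℝ | (∃ x : R, x ∈ IsLocalRing.maximalIdeal R ∧ x ≠ 0 ∧ ν (algebraMap R K x) = r) ∧
        0 ≤ r ∧ r < (y : ℝ) * t₁}.Finite ∧
    ({r : ℝ | (∃ x : R, x ∈ IsLocalRing.maximalIdeal R ∧ x ≠ 0 ∧ ν (algebraMap R K x) = r) ∧
        0 ≤ r ∧ r < (y : ℝ) * t₁}.ncard : WithBot ℕ∞)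
      < moduleLength R (R ⧸ (IsLocalRing.maximalIdeal R ^ y)) := by
  set S := {r : ℝ | (∃ x : R, x ∈ IsLocalRing.maximalIdeal R ∧ x ≠ 0 ∧
    ν (algebraMap R K x) = r) ∧ 0 ≤ r ∧ r < (y : ℝ) * t₁}
  have hne : ∀ x : R, x ≠ 0 → algebraMap R K x ≠ 0 := fun x hx => by simpa using hx
  let v : R → ℝ := fun x => ν (algebraMap R K x)
  have vmul : ∀ x y : R, x ≠ 0 → y ≠ 0 → v (x * y) = v x + v y := fun a b ha hb => by
    simpa [v] using hmul _ _ (hne a ha) (hne b hb)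
  have vadd : ∀ x y : R, x ≠ 0 → y ≠ 0 → x + y ≠ 0 → min (v x) (v y) ≤ v (x + y) :=
    fun a b ha hb hab => by
      simpa [v] using hadd _ _ (hne a ha) (hne b hb) (by rw [← map_add]; exact hne _ hab)
  have v1 : v 1 = 0 := by simpa using vmul 1 1 one_ne_zero one_ne_zero
  have ht₁pos : 0 < t₁ := by
    obtain ⟨x, hx, hx0, rfl⟩ := ht₁.1
    exact hdom x hx hx0
  have hI : IsLocalRing.maximalIdeal R ^ y ≤ valueIdeal v vmul vadd hnonneg (y * t₁) :=
    pow_le_valueIdeal v vmul vadd hnonneg (fun x hx hx0 => ht₁.2 ⟨x, hx, hx0, rfl⟩) y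
  have hlen : ∀ t : Finset ℝ, (t : Set ℝ) ⊆ S →
      (t.card : ℕ∞) + 1 ≤ Module.length R (R ⧸ IsLocalRing.maximalIdeal R ^ y) := by
    intro t ht
    have h0 : (0 : ℝ) ∉ t := fun h => by
      obtain ⟨⟨x, hx, hx0, hr⟩, -⟩ := ht h
      exact (hdom x hx hx0).ne' hr
    have := card_le_length_quotient v vmul vadd hnonneg hI (insert 0 t) fun r hr => by
      rcases Finset.mem_insert.mp hr with rfl | hr
      · exact ⟨⟨1, one_ne_zero, v1⟩, by positivity⟩
      · obtain ⟨⟨x, -, hx0, hxr⟩, -, hlt⟩ := ht hr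
        exact ⟨⟨x, hx0, hxr⟩, hlt⟩
    rwa [Finset.card_insert_of_notMem h0, Nat.cast_succ] at this
  have hfin : Module.length R (R ⧸ IsLocalRing.maximalIdeal R ^ y) ≠ ⊤ :=
    Module.length_ne_top_iff.mpr (IsLocalRing.isFiniteLength_quotient_maximalIdeal_pow R y)
  obtain ⟨n, hn⟩ := ENat.ne_top_iff_exists.mp hfin
  have hSfin : S.Finite := by
    by_contra hinf
    obtain ⟨t, ht, hcard⟩ := Set.Infinite.exists_subset_card_eq hinf n
    have := hlen t ht
    rw [hcard, ← hn] at this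
    norm_cast at this
    omega
  refine ⟨hSfin, ?_⟩
  have := hlen hSfin.toFinset (by simp)
  rw [← Set.ncard_eq_toFinset_card S hSfin, ← hn] at this
  rw [moduleLength, ← Module.coe_length, ← hn]
  norm_cast at this ⊢
end

section
/- Let R be a noetherian local domain and let ν be a valuation of the fraction field of R with values in (ℝ,+) that is nonnegative on R, with nonzero center p = {x ∈ R : ν(x) > 0} (a prime ideal of R). Assume ν(R∖{0}) is a well-ordered subset of ℝ and let t = min{ν(f) : f ∈ p∖{0}}. Then for every integer y ≥ 1, the set {φ ∈ ν(R∖{0}) : 0 < φ < y·t} is finite and its cardinality is strictly less than the length of the R_p-module R_p/p^y R_p, where R_p is the localization of R at p. -/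
theorem IsLocalRing.isArtinianRing_quotient_maximalIdeal_pow (A : Type*) [CommRing A]
    [IsLocalRing A] [IsNoetherianRing A] (n : ℕ) :
    IsArtinianRing (A ⧸ IsLocalRing.maximalIdeal A ^ n) := by
  have : Ring.KrullDimLE 0 (A ⧸ IsLocalRing.maximalIdeal A ^ n) :=
    Ring.krullDimLE_zero_iff.mpr fun J hJ ↦ by
      have hcomap : IsLocalRing.maximalIdeal A ≤ J.comap (Ideal.Quotient.mk _) :=
        (hJ.comap _).le_of_pow_le (Ideal.mk_ker.symm.le.trans (Ideal.ker_le_comap _))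
      refine Ideal.isMaximal_of_isIntegral_of_isMaximal_comap (R := A) J ?_
      have heq := (IsLocalRing.maximalIdeal.isMaximal A).eq_of_le (hJ.comap _).ne_top hcomap
      exact heq ▸ IsLocalRing.maximalIdeal.isMaximal A
  exact IsNoetherianRing.isArtinianRing_of_krullDimLE_zero

theorem moduleLength_eq_coe_length (R M : Type*) [Ring R] [AddCommGroup M] [Module R M] :
    moduleLength R M = (Module.length R M : WithBot ℕ∞) :=
  (Module.coe_length R M).symm

theorem moduleLength_quotient_maximalIdeal_pow_ne_top (A : Type*) [CommRing A]
    [IsLocalRing A] [IsNoetherianRing A] (n : ℕ) :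
    moduleLength A (A ⧸ IsLocalRing.maximalIdeal A ^ n) ≠ ⊤ := by
  have := IsLocalRing.isArtinianRing_quotient_maximalIdeal_pow A n
  have : IsArtinian A (A ⧸ IsLocalRing.maximalIdeal A ^ n) :=
    isArtinian_of_surjective_algebraMap
      (Ideal.Quotient.mk_surjective (I := IsLocalRing.maximalIdeal A ^ n))
  rw [moduleLength_eq_coe_length]
  exact fun h ↦ Module.length_ne_top (R := A) (M := A ⧸ IsLocalRing.maximalIdeal A ^ n)
    (WithBot.coe_injective h)

/-- A strictly antitone function on a finite set with `n + 1` elements yields a chain of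
length `n`. -/
theorem StrictAntiOn.le_krullDim {α β : Type*} [LinearOrder α] [Preorder β] {f : α → β}
    {s : Finset α} (hf : StrictAntiOn f s) {n : ℕ} (hs : s.card = n + 1) :
    (n : WithBot ℕ∞) ≤ Order.krullDim β := by
  let e := s.orderEmbOfFin hs
  exact Order.LTSeries.length_le_krullDim (LTSeries.mk n (fun i ↦ f (e i.rev)) (fun i j hij ↦
    hf (s.orderEmbOfFin_mem hs _) (s.orderEmbOfFin_mem hs _)
      (e.strictMono (Fin.rev_lt_rev.mpr hij))))

section ValuationIdeal

variable {R : Type*} [CommRing R]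

/-- The ideal `{x : x = 0 ∨ r ≤ w x}` attached to a nonnegative valuation `w` on a domain. -/
def valuationIdeal [IsDomain R] (w : R → ℝ)
    (hmul : ∀ x y : R, x ≠ 0 → y ≠ 0 → w (x * y) = w x + w y)
    (hadd : ∀ x y : R, x ≠ 0 → y ≠ 0 → x + y ≠ 0 → min (w x) (w y) ≤ w (x + y))
    (hnonneg : ∀ x : R, x ≠ 0 → 0 ≤ w x) (r : ℝ) : Ideal R where
  carrier := {x | x = 0 ∨ r ≤ w x}
  zero_mem' := Or.inl rfl
  add_mem' := by
    rintro a b (rfl | ha) (rfl | hb)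
    · simp
    · simp [hb]
    · simp [ha]
    · by_cases ha0 : a = 0
      · simp [ha0, hb]
      by_cases hb0 : b = 0
      · simp [hb0, ha]
      by_cases hab : a + b = 0
      · exact Or.inl hab
      · exact Or.inr ((le_min ha hb).trans (hadd a b ha0 hb0 hab))
  smul_mem' := by
    rintro c x (rfl | hx)
    · simp
    · by_cases hc0 : c = 0
      · simp [hc0]
      by_cases hx0 : x = 0
      · simp [hx0]
      refine Or.inr ?_
      rw [smul_eq_mul, hmul c x hc0 hx0]
      linarith [hnonneg c hc0]

variable [IsDomain R] {w : R → ℝ}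
    (hmul : ∀ x y : R, x ≠ 0 → y ≠ 0 → w (x * y) = w x + w y)
    (hadd : ∀ x y : R, x ≠ 0 → y ≠ 0 → x + y ≠ 0 → min (w x) (w y) ≤ w (x + y))
    (hnonneg : ∀ x : R, x ≠ 0 → 0 ≤ w x)

theorem mem_valuationIdeal {r : ℝ} {x : R} :
    x ∈ valuationIdeal w hmul hadd hnonneg r ↔ x = 0 ∨ r ≤ w x :=
  Iff.rfl

theorem valuationIdeal_antitone : Antitone (valuationIdeal w hmul hadd hnonneg) :=
  fun _ _ h _ ↦ Or.imp_right h.trans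

theorem valuationIdeal_mul_le (r s : ℝ) :
    valuationIdeal w hmul hadd hnonneg r * valuationIdeal w hmul hadd hnonneg s ≤
      valuationIdeal w hmul hadd hnonneg (r + s) := by
  refine Ideal.mul_le.mpr fun a ha b hb ↦ ?_
  by_cases ha0 : a = 0
  · simp [ha0]
  by_cases hb0 : b = 0
  · simp [hb0]
  refine Or.inr ?_
  rw [hmul a b ha0 hb0]
  exact add_le_add (ha.resolve_left ha0) (hb.resolve_left hb0)

theorem pow_le_valuationIdeal {p : Ideal R} {t : ℝ}
    (hp : p ≤ valuationIdeal w hmul hadd hnonneg t) (n : ℕ) :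
    p ^ n ≤ valuationIdeal w hmul hadd hnonneg (n * t) := by
  induction n with
  | zero =>
    intro x _
    by_cases hx : x = 0
    · exact Or.inl hx
    · exact Or.inr (by simpa using hnonneg x hx)
  | succ n ih =>
    rw [pow_succ, Nat.cast_add_one, add_one_mul]
    exact (Ideal.mul_mono ih hp).trans (valuationIdeal_mul_le hmul hadd hnonneg _ _)

theorem algebraMap_mem_map_valuationIdeal_iff (p : Ideal R) [p.IsPrime]
    (hcenter : ∀ x ∉ p, w x = 0) {r : ℝ} {x : R} :
    algebraMap R (Localization.AtPrime p) x ∈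
        (valuationIdeal w hmul hadd hnonneg r).map (algebraMap R (Localization.AtPrime p)) ↔
      x ∈ valuationIdeal w hmul hadd hnonneg r := by
  refine ⟨fun h ↦ ?_, Ideal.mem_map_of_mem _⟩
  rw [IsLocalization.algebraMap_mem_map_algebraMap_iff p.primeCompl] at h
  obtain ⟨s, hs, hsx⟩ := h
  have hs0 : s ≠ 0 := fun h0 ↦ hs (h0 ▸ p.zero_mem)
  by_cases hx : x = 0
  · exact Or.inl hx
  · have := hsx.resolve_left (mul_ne_zero hs0 hx)
    rw [hmul s x hs0 hx, hcenter s hs, zero_add] at this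
    exact Or.inr this

/-- The images of the valuation ideals in the quotient of the local ring of the center by a power
of its maximal ideal strictly decrease along the values below `n * t`. -/
theorem strictAntiOn_map_valuationIdeal (p : Ideal R) [p.IsPrime]
    (hcenter : ∀ x ∉ p, w x = 0) {t : ℝ} (hp : p ≤ valuationIdeal w hmul hadd hnonneg t) (n : ℕ)
    {T : Set ℝ} (hT : ∀ r ∈ T, r ≤ n * t) (hT' : ∀ r ∈ T, r < n * t → ∃ x : R, x ≠ 0 ∧ w x = r) :
    StrictAntiOn (fun r ↦ Submodule.map
      (Submodule.mkQ (p.map (algebraMap R (Localization.AtPrime p)) ^ n))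
      ((valuationIdeal w hmul hadd hnonneg r).map (algebraMap R (Localization.AtPrime p)))) T := by
  intro r hr r' hr' hlt
  refine lt_of_le_not_ge (Submodule.map_mono
    (Ideal.map_mono (valuationIdeal_antitone hmul hadd hnonneg hlt.le))) fun hle ↦ ?_
  obtain ⟨x, hx0, rfl⟩ := hT' r hr (hlt.trans_le (hT r' hr'))
  have hpow : p.map (algebraMap R (Localization.AtPrime p)) ^ n ≤
      (valuationIdeal w hmul hadd hnonneg r').map (algebraMap R (Localization.AtPrime p)) := by
    rw [← Ideal.map_pow]
    exact Ideal.map_mono ((pow_le_valuationIdeal hmul hadd hnonneg hp n).trans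
      (valuationIdeal_antitone hmul hadd hnonneg (hT r' hr')))
  rw [Submodule.map_le_iff_le_comap, Submodule.comap_map_mkQ, sup_eq_right.mpr hpow] at hle
  have hmem := hle (Ideal.mem_map_of_mem _
    (show x ∈ valuationIdeal w hmul hadd hnonneg (w x) from Or.inr le_rfl))
  rw [algebraMap_mem_map_valuationIdeal_iff hmul hadd hnonneg p hcenter] at hmem
  exact (hmem.resolve_left hx0).not_gt hlt

theorem card_add_one_le_moduleLength (p : Ideal R) [p.IsPrime]
    (hcenter : ∀ x ∉ p, w x = 0) {t : ℝ} (ht : 0 < t)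
    (hp : p ≤ valuationIdeal w hmul hadd hnonneg t) {n : ℕ} (hn : 1 ≤ n) (s : Finset ℝ)
    (hs : ∀ r ∈ s, (∃ x : R, x ≠ 0 ∧ w x = r) ∧ 0 < r ∧ r < n * t) :
    ((s.card + 1 : ℕ) : WithBot ℕ∞) ≤ moduleLength (Localization.AtPrime p)
      (Localization.AtPrime p ⧸ p.map (algebraMap R (Localization.AtPrime p)) ^ n) := by
  have hnt : 0 < n * t := mul_pos (by exact_mod_cast hn) ht
  have hone : w 1 = 0 := hcenter 1 ((Ideal.ne_top_iff_one p).mp Ideal.IsPrime.ne_top')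
  have hcard : (insert 0 (insert (n * t) s)).card = s.card + 1 + 1 := by
    rw [Finset.card_insert_of_notMem, Finset.card_insert_of_notMem]
    · exact fun h ↦ (hs _ h).2.2.false
    · rw [Finset.mem_insert, not_or]
      exact ⟨hnt.ne, fun h ↦ (hs _ h).2.1.false⟩
  refine StrictAntiOn.le_krullDim
    (strictAntiOn_map_valuationIdeal hmul hadd hnonneg p hcenter hp n ?_ ?_) hcard
  · intro r hr
    simp only [Finset.coe_insert, Set.mem_insert_iff, Finset.mem_coe] at hr
    rcases hr with rfl | rfl | hr
    exacts [hnt.le, le_rfl, (hs r hr).2.2.le]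
  · intro r hr hlt
    simp only [Finset.coe_insert, Set.mem_insert_iff, Finset.mem_coe] at hr
    rcases hr with rfl | rfl | hr
    exacts [⟨1, one_ne_zero, hone⟩, (hlt.false).elim, (hs r hr).1]

end ValuationIdeal

/-- Let `R` be a noetherian local domain and `ν` a real-valued valuation of
the fraction field of `R`, nonnegative on `R`, with nonzero center `p = {x : ν(x) > 0}`.
Assume `ν(R∖{0})` is well ordered and let `t = min{ν(f) : f ∈ p∖{0}}`.  Then for every `y ≥ 1`
the set `{φ ∈ ν(R∖{0}) : 0 < φ < y·t}` is finite of cardinality strictly less than the length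
of the `R_p`-module `R_p/p^y R_p`. -/
theorem stmt1 (R : Type*) [CommRing R] [IsDomain R] [IsNoetherianRing R] [IsLocalRing R]
    (K : Type*) [Field K] [Algebra R K] [IsFractionRing R K]
    (ν : K → ℝ)
    (hmul : ∀ x y : K, x ≠ 0 → y ≠ 0 → ν (x * y) = ν x + ν y)
    (hadd : ∀ x y : K, x ≠ 0 → y ≠ 0 → x + y ≠ 0 → min (ν x) (ν y) ≤ ν (x + y))
    (hnonneg : ∀ x : R, x ≠ 0 → 0 ≤ ν (algebraMap R K x))
    (p : Ideal R) [hp : p.IsPrime]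
    (hpcenter : ∀ x : R, x ∈ p ↔ (x = 0 ∨ 0 < ν (algebraMap R K x)))
    (hpne : p ≠ ⊥)
    (hWF : Set.IsWF {r : ℝ | ∃ x : R, x ≠ 0 ∧ ν (algebraMap R K x) = r})
    (t : ℝ)
    (ht : IsLeast {r : ℝ | ∃ x : R, x ∈ p ∧ x ≠ 0 ∧ ν (algebraMap R K x) = r} t)
    (y : ℕ) (hy : 1 ≤ y) :
    {r : ℝ | (∃ x : R, x ≠ 0 ∧ ν (algebraMap R K x) = r) ∧ 0 < r ∧ r < (y : ℝ) * t}.Finite ∧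
    ({r : ℝ | (∃ x : R, x ≠ 0 ∧ ν (algebraMap R K x) = r) ∧ 0 < r ∧
        r < (y : ℝ) * t}.ncard : WithBot ℕ∞)
      < moduleLength (Localization.AtPrime p)
          (Localization.AtPrime p ⧸
            (p.map (algebraMap R (Localization.AtPrime p)) ^ y)) := by
  have hinj : ∀ {x : R}, x ≠ 0 → algebraMap R K x ≠ 0 := fun hx ↦
    (map_ne_zero_iff _ (IsFractionRing.injective R K)).mpr hx
  have hmul' : ∀ x y : R, x ≠ 0 → y ≠ 0 →
      ν (algebraMap R K (x * y)) = ν (algebraMap R K x) + ν (algebraMap R K y) :=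
    fun x y hx hy ↦ by rw [map_mul, hmul _ _ (hinj hx) (hinj hy)]
  have hadd' : ∀ x y : R, x ≠ 0 → y ≠ 0 → x + y ≠ 0 →
      min (ν (algebraMap R K x)) (ν (algebraMap R K y)) ≤ ν (algebraMap R K (x + y)) :=
    fun x y hx hy hxy ↦ by
      rw [map_add]
      exact hadd _ _ (hinj hx) (hinj hy) (by rw [← map_add]; exact hinj hxy)
  have hcenter : ∀ x ∉ p, ν (algebraMap R K x) = 0 := fun x hx ↦ by
    rw [hpcenter, not_or, not_lt] at hx
    exact le_antisymm hx.2 (hnonneg x hx.1)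
  have htpos : 0 < t := by
    obtain ⟨x, hxp, hx0, rfl⟩ := ht.1
    exact ((hpcenter x).mp hxp).resolve_left hx0
  have hle : p ≤ valuationIdeal _ hmul' hadd' hnonneg t := fun x hx ↦
    or_iff_not_imp_left.mpr fun hx0 ↦ ht.2 ⟨x, hx, hx0, rfl⟩
  have hcard := card_add_one_le_moduleLength hmul' hadd' hnonneg p hcenter htpos hle hy
  have hfin : {r : ℝ | (∃ x : R, x ≠ 0 ∧ ν (algebraMap R K x) = r) ∧ 0 < r ∧
      r < (y : ℝ) * t}.Finite := by
    have : IsNoetherianRing (Localization.AtPrime p) :=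
      IsLocalization.isNoetherianRing p.primeCompl _ inferInstance
    have htop := moduleLength_quotient_maximalIdeal_pow_ne_top (Localization.AtPrime p) y
    rw [← Localization.AtPrime.map_eq_maximalIdeal, moduleLength_eq_coe_length] at htop
    obtain ⟨N, hN⟩ := ENat.ne_top_iff_exists.mp fun h ↦ htop (congrArg WithBot.some h)
    by_contra hinf
    obtain ⟨s, hs, hsN⟩ := Set.Infinite.exists_subset_card_eq hinf N
    have h := hcard s fun r hr ↦ hs hr
    rw [moduleLength_eq_coe_length, ← hN, hsN] at h
    exact absurd (by exact_mod_cast h : N + 1 ≤ N) (by lia)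
  refine ⟨hfin, lt_of_lt_of_le ?_ (hcard hfin.toFinset fun r hr ↦ hfin.mem_toFinset.mp hr)⟩
  rw [Set.ncard_eq_toFinset_card _ hfin]
  exact_mod_cast Nat.lt_succ_self _
end

section
/- Let R be a noetherian local domain, let A and B be subgroups of (ℝ,+), and let ν be a valuation of the fraction field of R with values in Γ = A × B ordered lexicographically, nonnegative on R. Let π : Γ → A be the first projection, ν₂ = π∘ν, p₁ = {x ∈ R : ν(x) > 0}, p₂ = {x ∈ R : ν₂(x) > 0}, and assume p₁ ≠ p₂ and that ν(R∖{0}) is well ordered. Let t₁ = min{ν(f) : f ∈ p₁∖{0}}. Fix φ₂ ∈ ν₂(R∖{0}) ∪ {0} and let φ̃₂ = min{ν(f) : f ∈ R∖{0}, ν₂(f) = φ₂}. Let M = Q_{φ₂}/Q_{φ₂}⁺. Then for every y₁ ∈ ℕ, the set (ν(R∖{0}) ∪ {0}) ∩ [φ̃₂, φ̃₂ + y₁·t₁) is finite, and the sum over its elements φ of length_{R_{p₁}}((P_φ/P_φ⁺) ⊗_R R_{p₁}) is at most length_{R_{p₁}}((M/p₁^{y₁}M) ⊗_R R_{p₁}).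 -/
open IsLocalRing in
/-- A finite module over a noetherian local ring killed by a power of the maximal ideal has finite
length. -/
theorem Module.length_ne_top_of_pow_maximalIdeal_le_annihilator {S X : Type*} [CommRing S]
    [IsNoetherianRing S] [IsLocalRing S] [AddCommGroup X] [Module S X] [Module.Finite S X] (n : ℕ)
    (h : maximalIdeal S ^ n ≤ Module.annihilator S X) : Module.length S X ≠ ⊤ := by
  rcases subsingleton_or_nontrivial X with hX | hX
  · simp
  have htop : maximalIdeal S ^ n ≠ ⊤ := fun htop ↦ by
    obtain ⟨x, hx⟩ := exists_ne (0 : X)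
    have h1 : (1 : S) ∈ Module.annihilator S X := h (by simp [htop])
    exact hx (by simpa using Module.mem_annihilator.mp h1 x)
  have : Nontrivial (S ⧸ maximalIdeal S ^ n) := Ideal.Quotient.nontrivial_iff.mpr htop
  have : IsLocalRing (S ⧸ maximalIdeal S ^ n) :=
    .of_surjective' _ (Ideal.Quotient.mk_surjective (I := maximalIdeal S ^ n))
  have : IsArtinianRing (S ⧸ maximalIdeal S ^ n) := by
    rw [isArtinianRing_iff_isNilpotent_maximalIdeal]
    have hle : maximalIdeal (S ⧸ maximalIdeal S ^ n) ≤
        (maximalIdeal S).map (Ideal.Quotient.mk (maximalIdeal S ^ n)) := by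
      intro a ha
      obtain ⟨s, rfl⟩ := Ideal.Quotient.mk_surjective a
      refine Ideal.mem_map_of_mem _ ?_
      rw [mem_maximalIdeal, mem_nonunits_iff] at ha ⊢
      exact fun hs ↦ ha (hs.map _)
    refine ⟨n, le_bot_iff.mp ((Ideal.pow_right_mono hle n).trans ?_)⟩
    rw [← Ideal.map_pow, Ideal.map_quotient_self]
  have htor : Module.IsTorsionBySet S X (maximalIdeal S ^ n : Ideal S) :=
    fun x a ↦ Module.mem_annihilator.mp (h a.2) x
  let _ := htor.module
  have : IsScalarTower S (S ⧸ maximalIdeal S ^ n) X := htor.isScalarTower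
  have : Module.Finite (S ⧸ maximalIdeal S ^ n) X := .of_restrictScalars_finite S _ X
  have : IsArtinian S X :=
    isArtinian_of_surjective_algebraMap (Ideal.Quotient.mk_surjective (I := maximalIdeal S ^ n))
  exact Module.length_ne_top

/-- A finite module over a noetherian ring killed by a power of a prime `p` has finite length
after localizing at `p`. -/
theorem Module.length_localizedModule_ne_top {R N : Type*} [CommRing R] [IsNoetherianRing R]
    [AddCommGroup N] [Module R N] [Module.Finite R N] (p : Ideal R) [p.IsPrime] (n : ℕ)
    (h : p ^ n ≤ Module.annihilator R N) :
    Module.length (Localization p.primeCompl) (LocalizedModule p.primeCompl N) ≠ ⊤ := by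
  have : IsNoetherianRing (Localization p.primeCompl) :=
    IsLocalization.isNoetherianRing p.primeCompl _ inferInstance
  have : Module.Finite (Localization p.primeCompl) (LocalizedModule p.primeCompl N) :=
    Module.Finite.of_isLocalizedModule p.primeCompl (LocalizedModule.mkLinearMap p.primeCompl N)
  have : IsLocalRing (Localization p.primeCompl) := Localization.AtPrime.isLocalRing p
  refine Module.length_ne_top_of_pow_maximalIdeal_le_annihilator n ?_
  rw [← Localization.AtPrime.map_eq_maximalIdeal, ← Ideal.map_pow, Ideal.map_le_iff_le_comap]
  intro r hr
  rw [Ideal.mem_comap, Module.mem_annihilator]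
  intro x
  induction x with
  | h m s =>
    rw [algebraMap_smul, LocalizedModule.smul'_mk, Module.mem_annihilator.mp (h hr),
      LocalizedModule.zero_mk]

theorem LocalizedModule.length_eq_add_of_exact {R N M P : Type*} [CommRing R] (S : Submonoid R)
    [AddCommGroup N] [AddCommGroup M] [AddCommGroup P] [Module R N] [Module R M] [Module R P]
    (f : N →ₗ[R] M) (g : M →ₗ[R] P) (hf : Function.Injective f) (hg : Function.Surjective g)
    (h : Function.Exact f g) :
    Module.length (Localization S) (LocalizedModule S M) =
      Module.length (Localization S) (LocalizedModule S N) +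
        Module.length (Localization S) (LocalizedModule S P) :=
  Module.length_eq_add_of_exact (LocalizedModule.map S f) (LocalizedModule.map S g)
    (IsLocalizedModule.map_injective S (LocalizedModule.mkLinearMap S N)
      (LocalizedModule.mkLinearMap S M) f hf)
    (IsLocalizedModule.map_surjective S (LocalizedModule.mkLinearMap S M)
      (LocalizedModule.mkLinearMap S P) g hg)
    (LocalizedModule.map_exact S f g h)

theorem LocalizedModule.length_le_of_surjective {R M P : Type*} [CommRing R] (S : Submonoid R)
    [AddCommGroup M] [AddCommGroup P] [Module R M] [Module R P]
    (g : M →ₗ[R] P) (hg : Function.Surjective g) :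
    Module.length (Localization S) (LocalizedModule S P) ≤
      Module.length (Localization S) (LocalizedModule S M) :=
  Module.length_le_of_surjective (LocalizedModule.map S g)
    (IsLocalizedModule.map_surjective S (LocalizedModule.mkLinearMap S M)
      (LocalizedModule.mkLinearMap S P) g hg)

/-- The length over `S⁻¹R` of the localization of the subquotient `N / (N ⊓ E)`. -/
noncomputable def Submodule.localizedLength {R M : Type*} [CommRing R] [AddCommGroup M] [Module R M]
    (S : Submonoid R) (N E : Submodule R M) : ℕ∞ :=
  Module.length (Localization S) (LocalizedModule S (N ⧸ E.comap N.subtype))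

theorem Submodule.localizedLength_add {R M : Type*} [CommRing R] [AddCommGroup M] [Module R M]
    (S : Submonoid R) {N F E : Submodule R M} (hEF : E ≤ F) (hFN : F ≤ N) :
    N.localizedLength S E = F.localizedLength S E + N.localizedLength S F := by
  refine LocalizedModule.length_eq_add_of_exact S
    (Submodule.mapQ (E.comap F.subtype) (E.comap N.subtype) (Submodule.inclusion hFN)
      (fun x hx ↦ hx))
    (Submodule.factor (Submodule.comap_mono hEF)) ?_
    (Submodule.factor_surjective _) ?_
  · rw [← LinearMap.ker_eq_bot, LinearMap.ker_eq_bot']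
    intro x hx
    obtain ⟨x, rfl⟩ := Submodule.mkQ_surjective _ x
    have hxE : Submodule.inclusion hFN x ∈ E.comap N.subtype :=
      (Submodule.Quotient.mk_eq_zero _).mp hx
    exact (Submodule.Quotient.mk_eq_zero _).mpr hxE
  · intro x
    obtain ⟨x, rfl⟩ := Submodule.mkQ_surjective _ x
    constructor
    · intro hx
      have hxF : (x : M) ∈ F := by simpa using hx
      exact ⟨Submodule.Quotient.mk ⟨x, hxF⟩, rfl⟩
    · rintro ⟨y, hy⟩
      obtain ⟨y, rfl⟩ := Submodule.mkQ_surjective _ y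
      rw [← hy]
      exact (Submodule.Quotient.mk_eq_zero _).mpr y.2

/-- For a decreasing family `P` with `P b ≤ Q a ≤ P a` when `a < b`, the localized lengths of
finitely many of the layers `P a / Q a` between `E` and `N` add up to at most that of `N / E`. -/
theorem Submodule.sum_localizedLength_le {R M ι : Type*} [CommRing R] [AddCommGroup M] [Module R M]
    [LinearOrder ι] (S : Submonoid R) (P Q : ι → Submodule R M) (hQ : ∀ a, Q a ≤ P a)
    (hlt : ∀ a b, a < b → P b ≤ Q a) (E : Submodule R M) (s : Finset ι) (hE : ∀ a ∈ s, E ≤ Q a)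
    (N : Submodule R M) (hEN : E ≤ N) (hN : ∀ a ∈ s, P a ≤ N) :
    ∑ a ∈ s, (P a).localizedLength S (Q a) ≤ N.localizedLength S E := by
  induction s using Finset.induction_on_min generalizing N with
  | empty => simp
  | insert a s ha ih =>
    have haN := hN a (Finset.mem_insert_self a s)
    have hEa := hE a (Finset.mem_insert_self a s)
    rw [Finset.sum_insert fun h ↦ (ha a h).false,
      Submodule.localizedLength_add S (hEa.trans (hQ a)) haN,
      Submodule.localizedLength_add S hEa (hQ a), add_comm]
    refine le_add_right (add_le_add_left ?_ _)
    exact ih (fun b hb ↦ hE b (Finset.mem_insert_of_mem hb)) _ hEa fun b hb ↦ hlt a b (ha b hb)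

/-- If `f` is nonzero on `s` and its sums over finite subsets of `s` are bounded by a
finite quantity, then `s` is finite. -/
theorem Set.finite_of_forall_finset_sum_le {ι : Type*} (f : ι → ℕ∞) (s : Set ι) (c : ℕ∞)
    (hc : c ≠ ⊤) (hf : ∀ a ∈ s, f a ≠ 0) (h : ∀ t : Finset ι, ↑t ⊆ s → ∑ a ∈ t, f a ≤ c) :
    s.Finite := by
  lift c to ℕ using hc
  by_contra hs
  obtain ⟨t, hts, ht⟩ := Set.Infinite.exists_subset_card_eq hs (c + 1)
  have h1 : ((c + 1 : ℕ) : ℕ∞) ≤ ∑ a ∈ t, f a := by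
    rw [← ht, Finset.cast_card]
    exact Finset.sum_le_sum fun a ha ↦ Order.one_le_iff_ne_zero.mpr (hf a (hts ha))
  have := h1.trans (h t hts)
  norm_cast at this
  omega

theorem WithBot.coe_finsetSum {ι α : Type*} [AddCommMonoid α] (s : Finset ι) (f : ι → α) :
    ((∑ i ∈ s, f i : α) : WithBot α) = ∑ i ∈ s, (f i : WithBot α) :=
  map_sum (WithBot.addHom : α →+ WithBot α) f s

/-- **Lemma 1 of the paper.**  `R` a noetherian local domain, `ν` a valuation of
its fraction field with values in `Γ = A × B ⊆ ℝ ×ₗ ℝ` (lex order), nonnegative on `R`,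
`ν₂ = π ∘ ν` the composed valuation, `p₁ ≠ p₂` the centers of `ν` and `ν₂`, `t₁ = ν(p₁)`,
`φ₂ ∈ ν₂(R∖{0}) ∪ {0}`, `φ̃₂` the least value of `ν` on elements with `ν₂`-value `φ₂`, and
`M = Q_{φ₂}/Q_{φ₂}⁺`.  Then for `y₁ ∈ ℕ` the set `(ν(R∖{0}) ∪ {0}) ∩ [φ̃₂, φ̃₂ + y₁t₁)` is
finite and the sum of the lengths of the localizations at `p₁` of the `P_φ/P_φ⁺` over it is at
most the length over `R_{p₁}` of the localization of `M/p₁^{y₁}M`. -/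
theorem stmt4 (R : Type*) [CommRing R] [IsDomain R] [IsNoetherianRing R] [IsLocalRing R]
    (K : Type*) [Field K] [Algebra R K] [IsFractionRing R K]
    (A B : AddSubgroup ℝ)
    (ν : K → ℝ ×ₗ ℝ)
    (hval : ∀ x : K, x ≠ 0 → (ofLex (ν x)).1 ∈ A ∧ (ofLex (ν x)).2 ∈ B)
    (hmul : ∀ x y : K, x ≠ 0 → y ≠ 0 → ν (x * y) = ν x + ν y)
    (hadd : ∀ x y : K, x ≠ 0 → y ≠ 0 → x + y ≠ 0 → min (ν x) (ν y) ≤ ν (x + y))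
    (hnonneg : ∀ x : R, x ≠ 0 → 0 ≤ ν (algebraMap R K x))
    (p₁ p₂ : Ideal R) [p₁.IsPrime] [p₂.IsPrime]
    (hp₁ : ∀ x : R, x ∈ p₁ ↔ (x = 0 ∨ 0 < ν (algebraMap R K x)))
    (hp₂ : ∀ x : R, x ∈ p₂ ↔ (x = 0 ∨ 0 < (ofLex (ν (algebraMap R K x))).1))
    (hne : p₁ ≠ p₂)
    (hWF : Set.IsWF {γ : ℝ ×ₗ ℝ | ∃ x : R, x ≠ 0 ∧ ν (algebraMap R K x) = γ})
    (t₁ : ℝ ×ₗ ℝ)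
    (ht₁ : IsLeast {γ : ℝ ×ₗ ℝ | ∃ x : R, x ∈ p₁ ∧ x ≠ 0 ∧ ν (algebraMap R K x) = γ} t₁)
    (φ₂ : ℝ)
    (hφ₂ : φ₂ = 0 ∨ ∃ x : R, x ≠ 0 ∧ (ofLex (ν (algebraMap R K x))).1 = φ₂)
    (φt : ℝ ×ₗ ℝ)
    (hφt : IsLeast {γ : ℝ ×ₗ ℝ | ∃ x : R, x ≠ 0 ∧ (ofLex (ν (algebraMap R K x))).1 = φ₂ ∧
      ν (algebraMap R K x) = γ} φt)
    (P Pplus : (ℝ ×ₗ ℝ) → Ideal R)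
    (hP : ∀ γ : ℝ ×ₗ ℝ, ∀ x : R, x ∈ P γ ↔ (x = 0 ∨ γ ≤ ν (algebraMap R K x)))
    (hPplus : ∀ γ : ℝ ×ₗ ℝ, ∀ x : R, x ∈ Pplus γ ↔ (x = 0 ∨ γ < ν (algebraMap R K x)))
    (Q Qplus : Ideal R)
    (hQ : ∀ x : R, x ∈ Q ↔ (x = 0 ∨ φ₂ ≤ (ofLex (ν (algebraMap R K x))).1))
    (hQplus : ∀ x : R, x ∈ Qplus ↔ (x = 0 ∨ φ₂ < (ofLex (ν (algebraMap R K x))).1))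
    (y₁ : ℕ) :
    {γ : ℝ ×ₗ ℝ | (γ = 0 ∨ ∃ x : R, x ≠ 0 ∧ ν (algebraMap R K x) = γ) ∧
        φt ≤ γ ∧ γ < φt + y₁ • t₁}.Finite ∧
    (∑ᶠ γ ∈ {γ : ℝ ×ₗ ℝ | (γ = 0 ∨ ∃ x : R, x ≠ 0 ∧ ν (algebraMap R K x) = γ) ∧
        φt ≤ γ ∧ γ < φt + y₁ • t₁},
        moduleLength (Localization p₁.primeCompl)
          (LocalizedModule p₁.primeCompl
            ((P γ) ⧸ (Submodule.comap (P γ).subtype (Pplus γ)))))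
      ≤ moduleLength (Localization p₁.primeCompl)
          (LocalizedModule p₁.primeCompl
            ((Q ⧸ (Submodule.comap Q.subtype Qplus)) ⧸
              (p₁ ^ y₁ • (⊤ : Submodule R (Q ⧸ (Submodule.comap Q.subtype Qplus)))))) := by
  have hinj : ∀ x : R, x ≠ 0 → algebraMap R K x ≠ 0 := fun x hx ↦
    (map_ne_zero_iff _ (IsFractionRing.injective R K)).mpr hx
  have hmulR : ∀ x y : R, x ≠ 0 → y ≠ 0 →
      ν (algebraMap R K (x * y)) = ν (algebraMap R K x) + ν (algebraMap R K y) := fun x y hx hy ↦ by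
    rw [map_mul, hmul _ _ (hinj x hx) (hinj y hy)]
  obtain ⟨⟨f₀, hf₀p, hf₀, hf₀t⟩, ht₁min⟩ := ht₁
  obtain ⟨⟨g₀, hg₀, hg₀φ, hg₀t⟩, hφtmin⟩ := hφt
  have ht₁fst : (ofLex t₁).1 ≤ 0 := by
    have hle : p₂ ≤ p₁ := fun x hx ↦ by
      rw [hp₁]
      exact ((hp₂ x).mp hx).imp_right fun h ↦ Prod.Lex.lt_iff.mpr (Or.inl h)
    obtain ⟨x, hx₁, hx₂⟩ := SetLike.exists_of_lt (lt_of_le_of_ne hle hne.symm)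
    rw [hp₂, not_or, not_lt] at hx₂
    have := ht₁min ⟨x, hx₁, hx₂.1, rfl⟩
    exact (Prod.Lex.monotone_fst _ _ this).trans hx₂.2
  have hφtfst : (ofLex φt).1 = φ₂ := hg₀t ▸ hg₀φ
  have hφt_le : ∀ x : R, x ≠ 0 → φ₂ ≤ (ofLex (ν (algebraMap R K x))).1 →
      φt ≤ ν (algebraMap R K x) := fun x hx h ↦ by
    rcases h.eq_or_lt with h | h
    · exact hφtmin ⟨x, hx, h.symm, rfl⟩
    · exact (Prod.Lex.lt_iff.mpr (Or.inl (by rwa [hφtfst]))).le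
  have hpow : ∀ n : ℕ, p₁ ^ n ≤ P (n • t₁) := fun n ↦ by
    induction n with
    | zero =>
      exact fun x _ ↦ (hP _ _).mpr ((em (x = 0)).imp_right fun h ↦ by simpa using hnonneg x h)
    | succ n ih =>
      rw [pow_succ, Ideal.mul_le]
      intro r hr s hs
      rw [hP]
      rcases eq_or_ne r 0 with rfl | hr0
      · simp
      rcases eq_or_ne s 0 with rfl | hs0
      · simp
      right
      rw [hmulR r s hr0 hs0, succ_nsmul]
      exact add_le_add (((hP _ _).mp (ih hr)).resolve_left hr0) (ht₁min ⟨s, hs, hs0, rfl⟩)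
  have hPP : ∀ γ, Pplus γ ≤ P γ := fun γ x hx ↦
    (hP γ x).mpr (((hPplus γ x).mp hx).imp_right le_of_lt)
  have hPlt : ∀ a b, a < b → P b ≤ Pplus a := fun a b hab x hx ↦
    (hPplus a x).mpr (((hP b x).mp hx).imp_right hab.trans_le)
  have hPQ : ∀ γ, φt ≤ γ → P γ ≤ Q := fun γ hγ x hx ↦
    (hQ x).mpr (((hP γ x).mp hx).imp_right fun h ↦
      hφtfst ▸ Prod.Lex.monotone_fst _ _ (hγ.trans h))
  have ht₁nonneg : 0 ≤ t₁ := hf₀t ▸ hnonneg f₀ hf₀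
  set E := P (φt + y₁ • t₁) with hE
  have hEQ : E ≤ Q := hPQ _ (le_add_of_nonneg_right (nsmul_nonneg ht₁nonneg y₁))
  have hQE : Qplus ≤ E := fun x hx ↦ (hP _ x).mpr (((hQplus x).mp hx).imp_right fun h ↦
    (Prod.Lex.lt_iff.mpr (Or.inl (lt_of_le_of_lt (by
      have : (ofLex (φt + y₁ • t₁)).1 = (ofLex φt).1 + y₁ • (ofLex t₁).1 := rfl
      rw [this, hφtfst]
      exact add_le_of_nonpos_right (nsmul_nonpos ht₁fst y₁)) h))).le)
  have hsmul : p₁ ^ y₁ • (⊤ : Submodule R (Q ⧸ Submodule.comap Q.subtype Qplus)) ≤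
      LinearMap.ker (Submodule.factor (Submodule.comap_mono hQE :
        Submodule.comap Q.subtype Qplus ≤ Submodule.comap Q.subtype E)) := by
    rw [Submodule.smul_le]
    intro r hr x _
    obtain ⟨x, rfl⟩ := Submodule.mkQ_surjective _ x
    rw [LinearMap.mem_ker, ← map_smul]
    refine (Submodule.Quotient.mk_eq_zero _).mpr ?_
    change r * (x : R) ∈ E
    rw [hE, hP]
    rcases eq_or_ne r 0 with rfl | hr0
    · simp
    rcases eq_or_ne (x : R) 0 with hx0 | hx0
    · simp [hx0]
    right
    rw [hmulR r x hr0 hx0, add_comm]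
    exact add_le_add (((hP _ _).mp (hpow y₁ hr)).resolve_left hr0)
      (hφt_le x hx0 (((hQ x).mp x.2).resolve_left hx0))
  set c := Module.length (Localization p₁.primeCompl) (LocalizedModule p₁.primeCompl
    ((Q ⧸ Submodule.comap Q.subtype Qplus) ⧸
      p₁ ^ y₁ • (⊤ : Submodule R (Q ⧸ Submodule.comap Q.subtype Qplus))))
  have hc : c ≠ ⊤ := by
    refine Module.length_localizedModule_ne_top p₁ y₁ fun r hr ↦
      Module.mem_annihilator.mpr fun x ↦ ?_
    obtain ⟨x, rfl⟩ := Submodule.mkQ_surjective _ x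
    rw [← map_smul]
    exact (Submodule.Quotient.mk_eq_zero _).mpr
      (Submodule.smul_mem_smul hr Submodule.mem_top)
  have hQc : Q.localizedLength p₁.primeCompl E ≤ c :=
    LocalizedModule.length_le_of_surjective p₁.primeCompl (Submodule.liftQ _ _ hsmul) fun x ↦ by
      obtain ⟨x, rfl⟩ := Submodule.factor_surjective (Submodule.comap_mono hQE) x
      exact ⟨Submodule.Quotient.mk x, rfl⟩
  set Γ₀ := {γ : ℝ ×ₗ ℝ | (γ = 0 ∨ ∃ x : R, x ≠ 0 ∧ ν (algebraMap R K x) = γ) ∧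
        φt ≤ γ ∧ γ < φt + y₁ • t₁}
  have hsum : ∀ s : Finset (ℝ ×ₗ ℝ), ↑s ⊆ Γ₀ →
      ∑ γ ∈ s, (P γ).localizedLength p₁.primeCompl (Pplus γ) ≤ c := fun s hs ↦
    (Submodule.sum_localizedLength_le p₁.primeCompl P Pplus hPP hPlt E s
      (fun γ hγ ↦ hPlt _ _ (hs hγ).2.2) Q hEQ fun γ hγ ↦ hPQ _ (hs hγ).2.1).trans hQc
  have hpos : ∀ γ ∈ Γ₀, (P γ).localizedLength p₁.primeCompl (Pplus γ) ≠ 0 := by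
    rintro γ ⟨hγ, -⟩
    obtain ⟨x, hx, rfl⟩ : ∃ x : R, x ≠ 0 ∧ ν (algebraMap R K x) = γ := by
      rcases hγ with rfl | hγ
      · refine ⟨1, one_ne_zero, ?_⟩
        simpa using hmul 1 1 one_ne_zero one_ne_zero
      · exact hγ
    have hxP : x ∈ P (ν (algebraMap R K x)) := (hP _ x).mpr (Or.inr le_rfl)
    rw [Submodule.localizedLength, Ne, Module.length_eq_zero_iff]
    intro hsub
    obtain ⟨s, hs, hsx⟩ := (LocalizedModule.subsingleton_iff (M := P (ν (algebraMap R K x)) ⧸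
      Submodule.comap (P (ν (algebraMap R K x))).subtype (Pplus (ν (algebraMap R K x))))).mp hsub
        (Submodule.Quotient.mk ⟨x, hxP⟩)
    rw [← Submodule.Quotient.mk_smul, Submodule.Quotient.mk_eq_zero] at hsx
    have hsx' : s * x ∈ Pplus (ν (algebraMap R K x)) := hsx
    have hsp : s ∉ p₁ := hs
    rw [hp₁, not_or, not_lt] at hsp
    have hlt := ((hPplus _ _).mp hsx').resolve_left (mul_ne_zero hsp.1 hx)
    rw [hmulR s x hsp.1 hx] at hlt
    exact hlt.not_ge (add_le_of_nonpos_left hsp.2)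
  have hfin : Γ₀.Finite := Set.finite_of_forall_finset_sum_le _ _ c hc hpos hsum
  refine ⟨hfin, ?_⟩
  rw [finsum_mem_eq_finite_toFinset_sum _ hfin]
  simp only [moduleLength, ← Module.coe_length]
  have := hsum hfin.toFinset (by simp)
  rw [← WithBot.coe_finsetSum]
  exact WithBot.coe_le_coe.mpr this
end

section
/- Let R be a noetherian local domain with maximal ideal m_R, let A and B be subgroups of (ℝ,+), and let ν be a valuation of the fraction field of R with values in Γ = A × B ordered lexicographically, dominating R. Let π : Γ → A be the first projection, ν₂ = π∘ν, and p₂ = {x ∈ R : ν₂(x) > 0}; assume (0) ≠ p₂ ≠ m_R and that ν(R∖{0}) is well ordered. Let t₁ = min{ν(f) : f ∈ m_R∖{0}} and t₂ = min{ν₂(f) : f ∈ p₂∖{0}}. For φ₂ ∈ ν₂(R∖{0}) ∪ {0} let φ̃₂ = min{ν(f) : f ∈ R∖{0}, ν₂(f) = φ₂}. Then there exist d ∈ ℕ and a function s : ℕ → ℕ such that for all y₂ ∈ ℕ and all y₁ ≥ s(y₂), the set {φ ∈ ν(m_R∖{0}) : 0 ≤ π(φ) < y₂·t₂ and φ̃₂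 ≤ φ < φ̃₂ + y₁·t₁ where φ₂ = π(φ)} is finite with cardinality at most d·y₁^a·y₂^b, where a is the Krull dimension of R/p₂ and b is the Krull dimension of the localization R_{p₂}. -/
section Length

variable {R M N P : Type*} [CommRing R] [AddCommGroup M] [Module R M]
  [AddCommGroup N] [Module R N] [AddCommGroup P] [Module R P]

/-- Length is subadditive over a three-term exact sequence. -/
lemma Module.length_le_add_of_exact (f : N →ₗ[R] M) (g : M →ₗ[R] P) (H : Function.Exact f g) :
    Module.length R M ≤ Module.length R N + Module.length R P := by
  rw [Module.length_eq_add_of_exact (LinearMap.ker g).subtype g.rangeRestrict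
    (Submodule.subtype_injective _) g.surjective_rangeRestrict
    (by rw [LinearMap.exact_iff, LinearMap.ker_rangeRestrict, Submodule.range_subtype])]
  refine add_le_add ?_ (Module.length_le_of_injective _ (Submodule.subtype_injective _))
  rw [LinearMap.exact_iff.mp H]
  exact Module.length_le_of_surjective _ f.surjective_rangeRestrict

lemma Module.length_quotient_anti {U V : Submodule R M} (h : U ≤ V) :
    Module.length R (M ⧸ V) ≤ Module.length R (M ⧸ U) := by
  rw [Module.length_quotient, Module.length_quotient]
  exact Order.coheight_anti h

lemma Module.length_quotient_add_one_le {U V : Submodule R M} (h : U < V) :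
    Module.length R (M ⧸ V) + 1 ≤ Module.length R (M ⧸ U) := by
  rw [Module.length_quotient, Module.length_quotient]
  exact Order.coheight_add_one_le h

/-- The successive jumps along a descending family of submodules add up to at most the length
of the corresponding quotient. -/
lemma Module.sum_le_length_quotient {Γ : Type*} [LinearOrder Γ] (W U : Γ → Submodule R M)
    (c : Γ → ℕ∞) (T : Finset Γ)
    (hc : ∀ γ ∈ T, Module.length R (M ⧸ W γ) + c γ ≤ Module.length R (M ⧸ U γ))
    (hWU : ∀ γ ∈ T, ∀ γ' ∈ T, γ < γ' → W γ' ≤ U γ)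
    (L : Submodule R M) (hL : ∀ γ ∈ T, L ≤ U γ) :
    ∑ γ ∈ T, c γ ≤ Module.length R (M ⧸ L) := by
  classical
  induction T using Finset.induction_on_max generalizing L with
  | empty => simp
  | insert a s ha ih =>
    rw [Finset.sum_insert (fun h ↦ (ha a h).false), add_comm]
    have h1 := ih (fun γ hγ ↦ hc γ (Finset.mem_insert_of_mem hγ))
      (fun γ hγ γ' hγ' ↦ hWU γ (Finset.mem_insert_of_mem hγ) γ' (Finset.mem_insert_of_mem hγ'))
      (W a) (fun γ hγ ↦ hWU γ (Finset.mem_insert_of_mem hγ) a (Finset.mem_insert_self _ _)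
        (ha γ hγ))
    calc _ ≤ Module.length R (M ⧸ W a) + c a := by gcongr
      _ ≤ _ := hc a (Finset.mem_insert_self _ _)
      _ ≤ _ := Module.length_quotient_anti (hL a (Finset.mem_insert_self _ _))

lemma Module.length_span_range_le {ι : Type*} [Fintype ι] (v : ι → M) (J : Ideal R)
    (hJ : ∀ r ∈ J, ∀ i, r • v i = 0) :
    Module.length R (Submodule.span R (Set.range v)) ≤
      Fintype.card ι * Module.length R (R ⧸ J) := by
  classical
  let g : ι → (R ⧸ J) →ₗ[R] M := fun i ↦
    Submodule.liftQ J (LinearMap.toSpanSingleton R M (v i)) (fun r hr ↦ by simpa using hJ r hr i)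
  let f : (ι → R ⧸ J) →ₗ[R] M := LinearMap.lsum R (fun _ ↦ R ⧸ J) R g
  have hle : Submodule.span R (Set.range v) ≤ LinearMap.range f := by
    rw [Submodule.span_le]
    rintro _ ⟨i, rfl⟩
    refine ⟨Pi.single i (Ideal.Quotient.mk J 1), ?_⟩
    rw [LinearMap.lsum_piSingle]
    change LinearMap.toSpanSingleton R M (v i) 1 = v i
    simp
  calc _ ≤ Module.length R (LinearMap.range f) :=
        Module.length_le_of_injective (Submodule.inclusion hle) (Submodule.inclusion_injective hle)
    _ ≤ Module.length R (ι → R ⧸ J) :=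
        Module.length_le_of_surjective _ f.surjective_rangeRestrict
    _ = _ := by simp

/-- If the jump from `U ⊔ span G` to `U` has length at most `r`, then `r` elements of `G` suffice
to generate `U ⊔ span G` modulo `U`. -/
lemma Submodule.exists_fin_span_sup_eq (G : Set M) (hG : (0 : M) ∈ G) (r : ℕ)
    (U : Submodule R M) (hfin : Module.length R (M ⧸ (U ⊔ span R G)) ≠ ⊤)
    (h : Module.length R (M ⧸ U) ≤ Module.length R (M ⧸ (U ⊔ span R G)) + r) :
    ∃ v : Fin r → M, (∀ i, v i ∈ G) ∧ U ⊔ span R (Set.range v) = U ⊔ span R G := by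
  induction r generalizing U with
  | zero =>
    refine ⟨Fin.elim0, fun i ↦ i.elim0, ?_⟩
    have : U = U ⊔ span R G := by
      by_contra hne
      have h1 := Module.length_quotient_add_one_le (lt_of_le_of_ne le_sup_left hne)
      have h2 := h1.trans h
      rw [Nat.cast_zero, add_zero] at h2
      exact (ENat.add_one_le_iff hfin).mp h2 |>.false
    rw [Set.range_eq_empty, span_empty, sup_bot_eq]
    exact this
  | succ r ih =>
    by_cases hGU : G ⊆ U
    · refine ⟨fun _ ↦ 0, fun _ ↦ hG, ?_⟩
      rw [sup_eq_left.mpr (span_le.mpr hGU), sup_eq_left, span_le]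
      rintro _ ⟨i, rfl⟩
      exact U.zero_mem
    · obtain ⟨x, hxG, hxU⟩ := Set.not_subset.mp hGU
      have hlt : U < U ⊔ span R {x} := by
        refine lt_of_le_of_ne le_sup_left fun e ↦ hxU ?_
        rw [SetLike.mem_coe, e]
        exact le_sup_right (a := U) (mem_span_singleton_self x)
      have heq : U ⊔ span R {x} ⊔ span R G = U ⊔ span R G := by
        rw [sup_assoc, sup_eq_right.mpr (span_mono (Set.singleton_subset_iff.mpr hxG) : span R {x} ≤ span R G)]
      have h1 := (Module.length_quotient_add_one_le hlt).trans h
      rw [Nat.cast_succ, ← add_assoc] at h1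
      obtain ⟨v, hv, hspan⟩ := ih (U ⊔ span R {x}) (heq ▸ hfin)
        (by rw [heq]; exact (ENat.add_le_add_iff_right (by simp)).mp h1)
      refine ⟨Fin.cons x v, Fin.cases hxG hv, ?_⟩
      rw [Fin.range_cons, ← heq, ← hspan, span_insert, sup_assoc]

end Length

section HilbertSamuel

variable {R : Type*} [CommRing R]

lemma Ideal.length_quotient_sup_span_pow_le (I : Ideal R) (y : R) (n : ℕ) :
    Module.length R (R ⧸ (I ⊔ span {y ^ n})) ≤ n * Module.length R (R ⧸ (I ⊔ span {y})) := by
  induction n with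
  | zero =>
    have : I ⊔ span {y ^ 0} = ⊤ := by simp
    rw [this]
    simp
  | succ n ih =>
    have hf : (I ⊔ span {y ^ n}) ≤ Submodule.comap (LinearMap.mulLeft R y)
        (I ⊔ span {y ^ (n + 1)}) := by
      refine sup_le (fun a ha ↦ ?_) ?_
      · exact mem_sup_left (I.mul_mem_left y ha)
      · rw [Ideal.span, Submodule.span_singleton_le_iff_mem]
        refine mem_sup_right (mem_span_singleton.mpr ?_)
        simp [pow_succ']
    have hg : I ⊔ span {y ^ (n + 1)} ≤ I ⊔ span {y} :=
      sup_le_sup_left ((span_singleton_le_span_singleton).mpr (dvd_pow_self y n.succ_ne_zero)) _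
    have H : Function.Exact (Submodule.mapQ _ _ _ hf) (Submodule.factor hg) := by
      intro x
      obtain ⟨x, rfl⟩ := Submodule.Quotient.mk_surjective _ x
      constructor
      · intro hx
        have hx' : x ∈ I ⊔ span {y} := (Submodule.Quotient.mk_eq_zero _).mp hx
        obtain ⟨a, ha, b, hb, rfl⟩ := Submodule.mem_sup.mp hx'
        obtain ⟨c, rfl⟩ := mem_span_singleton'.mp hb
        refine ⟨Submodule.Quotient.mk c, ?_⟩
        rw [Submodule.mapQ_apply, Submodule.Quotient.eq, LinearMap.mulLeft_apply]
        refine mem_sup_left ?_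
        have : y * c - (a + c * y) = -a := by ring
        rw [this]
        exact I.neg_mem ha
      · rintro ⟨c, hc⟩
        obtain ⟨c, rfl⟩ := Submodule.Quotient.mk_surjective _ c
        rw [← hc]
        refine (Submodule.Quotient.mk_eq_zero _).mpr ?_
        exact mem_sup_right (mem_span_singleton.mpr (Dvd.intro c rfl))
    have := Module.length_le_add_of_exact _ _ H
    refine this.trans ?_
    rw [Nat.cast_succ, add_mul, one_mul]
    gcongr

lemma Ideal.length_quotient_sup_span_image_pow_le (t : Finset R) (n : ℕ) (I : Ideal R) :
    Module.length R (R ⧸ (I ⊔ span ((· ^ n) '' (t : Set R)))) ≤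
      (n ^ t.card : ℕ) * Module.length R (R ⧸ (I ⊔ span (t : Set R))) := by
  classical
  induction t using Finset.induction_on generalizing I with
  | empty =>
    rw [Finset.coe_empty, Set.image_empty]
    simp
  | insert y t hy ih =>
    rw [Finset.card_insert_of_notMem hy, Finset.coe_insert, Set.image_insert_eq, span_insert,
      span_insert, sup_comm (span {y ^ n}), ← sup_assoc, ← sup_assoc]
    refine (length_quotient_sup_span_pow_le _ y n).trans ?_
    rw [sup_assoc, sup_comm (span _), ← sup_assoc, pow_succ', Nat.cast_mul, mul_assoc]
    gcongr
    exact ih _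

/-- Upper bound for the Hilbert-Samuel function of a noetherian local ring. -/
lemma IsLocalRing.exists_length_quotient_maximalIdeal_pow_le [IsNoetherianRing R] [IsLocalRing R]
    (d : ℕ) (hd : ringKrullDim R ≤ d) :
    ∃ C : ℕ, ∀ n : ℕ, Module.length R (R ⧸ maximalIdeal R ^ n) ≤ (C * n ^ d : ℕ) := by
  obtain ⟨t, ht, hcard⟩ := (maximalIdeal R).exists_finset_card_eq_height_of_isNoetherianRing
  have htd : t.card ≤ d := by
    rw [← maximalIdeal_height_eq_ringKrullDim, ← hcard] at hd
    exact_mod_cast hd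
  have := quotient_artinian_of_mem_minimalPrimes_of_isLocalRing _ ht
  have : IsArtinian R (R ⧸ Ideal.span (t : Set R)) :=
    isArtinian_of_surjective_algebraMap (R := R ⧸ Ideal.span (t : Set R))
      Ideal.Quotient.mk_surjective
  obtain ⟨C, hC⟩ := ENat.ne_top_iff_exists.mp
    (Module.length_ne_top (R := R) (M := R ⧸ Ideal.span (t : Set R)))
  refine ⟨C, fun n ↦ ?_⟩
  rcases Nat.eq_zero_or_pos n with rfl | hn
  · rw [pow_zero, Ideal.one_eq_top]
    simp
  have hle : (⊥ : Ideal R) ⊔ Ideal.span ((· ^ n) '' (t : Set R)) ≤ maximalIdeal R ^ n := by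
    rw [bot_sup_eq, Ideal.span_le]
    rintro _ ⟨x, hx, rfl⟩
    exact Ideal.pow_mem_pow (ht.1.2 (Ideal.subset_span hx)) n
  refine (Module.length_quotient_anti hle).trans
    ((Ideal.length_quotient_sup_span_image_pow_le t n ⊥).trans ?_)
  rw [bot_sup_eq, ← hC]
  norm_cast
  rw [mul_comm]
  gcongr

lemma IsLocalRing.exists_length_quotient_sup_pow_le [IsNoetherianRing R] [IsLocalRing R]
    (I : Ideal R) (d : ℕ) (hd : ringKrullDim (R ⧸ I) ≤ d) :
    ∃ C : ℕ, ∀ n : ℕ, Module.length R (R ⧸ (I ⊔ maximalIdeal R ^ n)) ≤ (C * n ^ d : ℕ) := by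
  by_cases hI : I = ⊤
  · refine ⟨0, fun n ↦ ?_⟩
    rw [hI, top_sup_eq]
    simp
  have : Nontrivial (R ⧸ I) := Ideal.Quotient.nontrivial_iff.mpr hI
  have : IsLocalRing (R ⧸ I) := .of_surjective' _ Ideal.Quotient.mk_surjective
  obtain ⟨C, hC⟩ := exists_length_quotient_maximalIdeal_pow_le (R := R ⧸ I) d hd
  refine ⟨C, fun n ↦ le_trans ?_ (hC n)⟩
  rw [← Module.length_eq_of_surjective (S := R) (R := R ⧸ I) Ideal.Quotient.mk_surjective]
  have hle : maximalIdeal (R ⧸ I) ^ n ≤ (maximalIdeal R ^ n).map (Ideal.Quotient.mk I) := by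
    rw [Ideal.map_pow]
    refine Ideal.pow_right_mono (fun x hx ↦ ?_) n
    obtain ⟨x, rfl⟩ := Ideal.Quotient.mk_surjective x
    refine Ideal.mem_map_of_mem _ ?_
    rw [mem_maximalIdeal, mem_nonunits_iff] at hx ⊢
    exact fun h ↦ hx (h.map _)
  let e := DoubleQuot.quotQuotEquivQuotSupₐ R I (maximalIdeal R ^ n)
  rw [← e.toLinearEquiv.length_eq]
  exact Module.length_le_of_surjective ((Ideal.Quotient.factorₐ R hle).toLinearMap)
    (Ideal.Quotient.factor_surjective hle)

end HilbertSamuel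

section Rank

variable {R : Type*} [CommRing R]

/-- Let `p` be a prime of a noetherian local ring. A finite module modulo `N`, killed by `p`, and
generated by `r` elements up to `p`-torsion, has Hilbert-Samuel function eventually bounded by
`(r * e + 1) * n ^ dim (R ⧸ p)`, with `e` depending on `p` only. -/
lemma IsLocalRing.exists_length_quotient_sup_smul_top_le [IsNoetherianRing R] [IsLocalRing R]
    (p : Ideal R) [p.IsPrime] (hp : p ≠ maximalIdeal R) (a : ℕ) (ha : ringKrullDim (R ⧸ p) ≤ a) :
    ∃ e : ℕ, ∀ (X : Type _) [AddCommGroup X] [Module R X] [Module.Finite R X]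
      (N : Submodule R X) (_ : ∀ c ∈ p, ∀ x : X, c • x ∈ N) (r : ℕ) (v : Fin r → X) (s : R)
      (_ : s ∉ p) (_ : ∀ x : X, s • x ∈ N ⊔ Submodule.span R (Set.range v)),
      ∃ n₀ : ℕ, ∀ n ≥ n₀,
        Module.length R (X ⧸ (N ⊔ maximalIdeal R ^ n • (⊤ : Submodule R X))) ≤
          ((r * e + 1) * n ^ a : ℕ) := by
  obtain ⟨e, he⟩ := exists_length_quotient_sup_pow_le p a ha
  refine ⟨e, fun X _ _ _ N hN r v s hs hv ↦ ?_⟩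
  obtain ⟨k, g, hg⟩ := Module.Finite.exists_fin (R := R) (M := X)
  have hdim : ringKrullDim (R ⧸ (p ⊔ Ideal.span {s})) + 1 ≤ (a : WithBot ℕ∞) := by
    refine le_trans (ringKrullDim_succ_le_of_surjective
      (Ideal.Quotient.factor (le_sup_left : p ≤ p ⊔ Ideal.span {s}))
      (Ideal.Quotient.factor_surjective _) (r := Ideal.Quotient.mk p s) ?_ ?_) ha
    · rw [mem_nonZeroDivisors_iff_ne_zero]
      rwa [Ne, Ideal.Quotient.eq_zero_iff_mem]
    · rw [Ideal.Quotient.factor_mk, Ideal.Quotient.eq_zero_iff_mem]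
      exact Ideal.mem_sup_right (Ideal.mem_span_singleton_self s)
  have ha0 : a ≠ 0 := by
    rintro rfl
    have hprime : Ring.KrullDimLE 0 (R ⧸ p) := Ring.krullDimLE_iff.mpr (by simpa using ha)
    have hf : IsField (R ⧸ p) := Ring.KrullDimLE.isField_of_isDomain
    exact hp (eq_maximalIdeal (Ideal.Quotient.maximal_of_isField p hf))
  obtain ⟨a, rfl⟩ := Nat.exists_eq_succ_of_ne_zero ha0
  have hdim' : ringKrullDim (R ⧸ (p ⊔ Ideal.span {s})) ≤ (a : WithBot ℕ∞) := by
    rw [Nat.cast_succ] at hdim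
    exact ENat.WithBot.add_le_add_one_right_iff.mp hdim
  obtain ⟨C, hC⟩ := exists_length_quotient_sup_pow_le _ a hdim'
  refine ⟨k * C, fun n hn ↦ ?_⟩
  set T := N ⊔ maximalIdeal R ^ n • (⊤ : Submodule R X) with hT
  have hNT : N ≤ T := le_sup_left
  have hmT : ∀ c ∈ maximalIdeal R ^ n, ∀ x : X, c • x ∈ T := fun c hc x ↦
    Submodule.mem_sup_right (Submodule.smul_mem_smul hc trivial)
  have hkill : ∀ c ∈ p ⊔ maximalIdeal R ^ n, ∀ x : X, c • x ∈ T := by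
    intro c hc x
    obtain ⟨c₁, h₁, c₂, h₂, rfl⟩ := Submodule.mem_sup.mp hc
    rw [add_smul]
    exact T.add_mem (hNT (hN _ h₁ x)) (hmT _ h₂ x)
  let Y : Submodule R (X ⧸ T) := Submodule.span R (Set.range fun i ↦ T.mkQ (v i))
  have hvY : ∀ x ∈ N ⊔ Submodule.span R (Set.range v), T.mkQ x ∈ Y := by
    intro x hx
    have : N ⊔ Submodule.span R (Set.range v) ≤ Y.comap T.mkQ := by
      refine sup_le (fun x hx ↦ ?_) ?_
      · have : T.mkQ x = 0 := (Submodule.Quotient.mk_eq_zero _).mpr (hNT hx)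
        rw [Submodule.mem_comap, this]
        exact Y.zero_mem
      · rw [Submodule.span_le]
        rintro _ ⟨i, rfl⟩
        exact Submodule.subset_span ⟨i, rfl⟩
    exact this hx
  have h1 : Module.length R Y ≤ (r * (e * n ^ (a + 1)) : ℕ) := by
    refine (Module.length_span_range_le _ (p ⊔ maximalIdeal R ^ n) ?_).trans ?_
    · intro c hc i
      rw [← map_smul]
      exact (Submodule.Quotient.mk_eq_zero _).mpr (hkill c hc _)
    · rw [Fintype.card_fin, Nat.cast_mul]
      gcongr
      exact he n
  have h2 : Module.length R ((X ⧸ T) ⧸ Y) ≤ (k * (C * n ^ a) : ℕ) := by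
    have htop : Submodule.span R (Set.range fun i ↦ Y.mkQ (T.mkQ (g i))) = ⊤ := by
      have : (Set.range fun i ↦ Y.mkQ (T.mkQ (g i))) = (Y.mkQ ∘ₗ T.mkQ) '' Set.range g := by
        rw [← Set.range_comp]
        rfl
      rw [this, ← Submodule.map_span, hg, Submodule.map_top, LinearMap.range_eq_top]
      exact Y.mkQ_surjective.comp T.mkQ_surjective
    rw [← Module.length_top, ← htop]
    refine (Module.length_span_range_le _ ((p ⊔ Ideal.span {s}) ⊔ maximalIdeal R ^ n) ?_).trans ?_
    · intro c hc i
      rw [← map_smul, ← map_smul]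
      refine (Submodule.Quotient.mk_eq_zero _).mpr ?_
      obtain ⟨c', hc', c₂, h₂, rfl⟩ := Submodule.mem_sup.mp hc
      obtain ⟨c₁, h₁, c₃, h₃, rfl⟩ := Submodule.mem_sup.mp hc'
      obtain ⟨d, rfl⟩ := Ideal.mem_span_singleton'.mp h₃
      rw [add_smul, add_smul, mul_smul, map_add, map_add]
      refine Y.add_mem (Y.add_mem ?_ ?_) ?_
      · exact hvY _ (Submodule.mem_sup_left (hN _ h₁ _))
      · rw [map_smul]
        exact Y.smul_mem _ (hvY _ (hv _))
      · rw [show T.mkQ (c₂ • g i) = 0 from (Submodule.Quotient.mk_eq_zero _).mpr (hmT _ h₂ _)]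
        exact Y.zero_mem
    · rw [Fintype.card_fin, Nat.cast_mul]
      gcongr
      exact hC n
  rw [Module.length_eq_add_of_exact Y.subtype Y.mkQ Y.subtype_injective Y.mkQ_surjective
    (LinearMap.exact_subtype_mkQ Y)]
  refine (add_le_add h1 h2).trans ?_
  norm_cast
  calc r * (e * n ^ (a + 1)) + k * (C * n ^ a) = r * e * n ^ (a + 1) + (k * C) * n ^ a := by ring
    _ ≤ r * e * n ^ (a + 1) + n * n ^ a := by gcongr
    _ = _ := by rw [Nat.succ_eq_add_one]; ring

/-- If the extensions of `J ≤ I` to the localization at `p` differ by length `r`, then `I` is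
generated modulo `J` by `r` elements up to multiplication by some `s ∉ p`. -/
lemma Ideal.exists_fin_smul_mem_sup_span [IsNoetherianRing R] (p : Ideal R) [p.IsPrime]
    (J I : Ideal R) (hJI : J ≤ I) (r : ℕ)
    (hfin : Module.length (Localization.AtPrime p) (Localization.AtPrime p ⧸
      I.map (algebraMap R (Localization.AtPrime p))) ≠ ⊤)
    (h : Module.length (Localization.AtPrime p) (Localization.AtPrime p ⧸
        J.map (algebraMap R (Localization.AtPrime p))) ≤
      Module.length (Localization.AtPrime p) (Localization.AtPrime p ⧸
        I.map (algebraMap R (Localization.AtPrime p))) + r) :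
    ∃ v : Fin r → R, (∀ i, v i ∈ I) ∧ ∃ s ∉ p, ∀ x ∈ I, s * x ∈ J ⊔ span (Set.range v) := by
  have hsup : J.map (algebraMap R (Localization.AtPrime p)) ⊔
      Submodule.span (Localization.AtPrime p) (algebraMap R (Localization.AtPrime p) '' I) =
      I.map (algebraMap R (Localization.AtPrime p)) := sup_eq_right.mpr (map_mono hJI)
  obtain ⟨w, hw, hspan⟩ := Submodule.exists_fin_span_sup_eq
    (algebraMap R (Localization.AtPrime p) '' I) ⟨0, I.zero_mem, map_zero _⟩ r
    (J.map (algebraMap R (Localization.AtPrime p))) (by rwa [hsup]) (by rwa [hsup])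
  choose v hvI hvw using hw
  refine ⟨v, hvI, ?_⟩
  have hI : ∀ x ∈ I, ∃ s ∉ p, s * x ∈ J ⊔ span (Set.range v) := by
    intro x hx
    have hx' : algebraMap R (Localization.AtPrime p) x ∈
        (J ⊔ span (Set.range v)).map (algebraMap R (Localization.AtPrime p)) := by
      have hr : Set.range w = algebraMap R (Localization.AtPrime p) '' Set.range v := by
        rw [← Set.range_comp]
        exact congrArg _ (funext fun i ↦ (hvw i).symm)
      rw [map_sup, map_span, ← hr]
      change _ ∈ _ ⊔ Submodule.span _ _
      rw [hspan, hsup]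
      exact mem_map_of_mem _ hx
    obtain ⟨s, hs, h⟩ := (IsLocalization.algebraMap_mem_map_algebraMap_iff p.primeCompl
      (Localization.AtPrime p) _ x).mp hx'
    exact ⟨s, hs, h⟩
  obtain ⟨t, ht⟩ := (IsNoetherian.noetherian I : I.FG)
  have hmem : ∀ x : t, (x : R) ∈ I := fun x ↦ ht ▸ Submodule.subset_span x.2
  choose σ hσp hσ using fun x : t ↦ hI x (hmem x)
  refine ⟨∏ x, σ x, ?_, ?_⟩
  · exact p.primeCompl.prod_mem (fun x _ ↦ hσp x)
  · intro x hx
    rw [← ht] at hx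
    refine Submodule.span_induction (p := fun x _ ↦ (∏ x, σ x) * x ∈ J ⊔ span (Set.range v))
      ?_ ?_ ?_ ?_ hx
    · intro y hy
      obtain ⟨c, hc⟩ := Finset.dvd_prod_of_mem σ (Finset.mem_univ ⟨y, hy⟩)
      rw [hc, mul_right_comm]
      exact mul_mem_right _ _ (hσ ⟨y, hy⟩)
    · simp
    · intro y z _ _ hy hz
      rw [mul_add]
      exact add_mem hy hz
    · intro c y _ hy
      rw [smul_eq_mul, mul_left_comm]
      exact mul_mem_left _ _ hy

end Rank

section ValuationIdeals

/-- A valuation-like function on the nonzero elements of a ring, with nonnegative values. -/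
structure IsNonnegValuation {R Γ : Type*} [CommRing R] [AddCommGroup Γ] [LinearOrder Γ]
    (v : R → Γ) : Prop where
  nonneg : ∀ x, x ≠ 0 → 0 ≤ v x
  map_mul : ∀ x y, x ≠ 0 → y ≠ 0 → v (x * y) = v x + v y
  map_add : ∀ x y, x ≠ 0 → y ≠ 0 → x + y ≠ 0 → min (v x) (v y) ≤ v (x + y)

variable {R Γ : Type*} [CommRing R] [AddCommGroup Γ] [LinearOrder Γ] [IsOrderedAddMonoid Γ]
  {v : R → Γ}

/-- The ideal of elements with value in an upper set. -/
def IsNonnegValuation.ideal (hv : IsNonnegValuation v) (U : UpperSet Γ) : Ideal R where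
  carrier := {x | x ≠ 0 → v x ∈ U}
  zero_mem' h := (h rfl).elim
  add_mem' {x y} hx hy hxy := by
    by_cases hx0 : x = 0
    · subst hx0
      rw [zero_add] at hxy ⊢
      exact hy hxy
    by_cases hy0 : y = 0
    · subst hy0
      rw [add_zero] at hxy ⊢
      exact hx hxy
    have h := hv.map_add x y hx0 hy0 hxy
    rcases min_choice (v x) (v y) with e | e <;> rw [e] at h
    · exact U.upper h (hx hx0)
    · exact U.upper h (hy hy0)
  smul_mem' c x hx hcx := by
    rw [smul_eq_mul] at hcx ⊢
    have hc0 := left_ne_zero_of_mul hcx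
    have hx0 := right_ne_zero_of_mul hcx
    rw [hv.map_mul c x hc0 hx0]
    exact U.upper (le_add_of_nonneg_left (hv.nonneg c hc0)) (hx hx0)

lemma IsNonnegValuation.mem_ideal (hv : IsNonnegValuation v) {U : UpperSet Γ} {x : R} :
    x ∈ hv.ideal U ↔ (x ≠ 0 → v x ∈ U) := Iff.rfl

lemma IsNonnegValuation.pow_le_ideal (hv : IsNonnegValuation v) (q : Ideal R) (t : Γ)
    (hq : ∀ x ∈ q, x ≠ 0 → t ≤ v x) (n : ℕ) : q ^ n ≤ hv.ideal (UpperSet.Ici (n • t)) := by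
  induction n with
  | zero =>
    intro x _ hx
    rw [zero_nsmul]
    exact hv.nonneg x hx
  | succ n ih =>
    rw [pow_succ, Ideal.mul_le]
    intro x hx y hy hxy
    have hx0 := left_ne_zero_of_mul hxy
    have hy0 := right_ne_zero_of_mul hxy
    rw [hv.map_mul x y hx0 hy0, succ_nsmul]
    exact add_le_add (ih hx hx0) (hq y hy hy0)

lemma Set.finite_and_ncard_le_of_forall_finset {α : Type*} (S : Set α) (B : ℕ)
    (h : ∀ T : Finset α, (T : Set α) ⊆ S → T.card ≤ B) : S.Finite ∧ S.ncard ≤ B := by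
  have hfin : S.Finite := by
    by_contra hS
    obtain ⟨T, hT, hcard⟩ := Set.Infinite.exists_subset_card_eq hS (B + 1)
    have := h T hT
    omega
  refine ⟨hfin, ?_⟩
  rw [Set.ncard_eq_toFinset_card S hfin]
  exact h _ (by simp)

/-- A set of values attained on `I`, all smaller than every value attained on `N`, has at most as
many elements as the length of `I ⧸ N`. -/
lemma IsNonnegValuation.finite_ncard_le_of_length_le (hv : IsNonnegValuation v) (I : Ideal R)
    (N : Submodule R I) (B : ℕ) (hB : Module.length R (I ⧸ N) ≤ B) (G : Set Γ)
    (hG : ∀ γ ∈ G, ∃ x ∈ I, x ≠ 0 ∧ v x = γ)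
    (hN : ∀ γ ∈ G, N ≤ (hv.ideal (UpperSet.Ioi γ)).submoduleOf I) :
    G.Finite ∧ G.ncard ≤ B := by
  refine Set.finite_and_ncard_le_of_forall_finset G B fun T hT ↦ ?_
  have h := Module.sum_le_length_quotient
    (fun γ ↦ (hv.ideal (UpperSet.Ici γ)).submoduleOf I)
    (fun γ ↦ (hv.ideal (UpperSet.Ioi γ)).submoduleOf I) (fun _ ↦ 1) T ?_ ?_ N
    (fun γ hγ ↦ hN γ (hT hγ))
  · have h' := h.trans hB
    rw [Finset.sum_const, nsmul_one] at h'
    exact_mod_cast h'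
  · intro γ hγ
    refine Module.length_quotient_add_one_le (lt_of_le_of_ne ?_ ?_)
    · intro x hx hx0
      exact (show γ < v x from hx hx0).le
    · intro e
      obtain ⟨x, hxI, hx0, rfl⟩ := hG γ (hT hγ)
      have hx : (⟨x, hxI⟩ : I) ∈ (hv.ideal (UpperSet.Ici (v x))).submoduleOf I :=
        fun _ ↦ le_refl (v x)
      rw [← e] at hx
      exact lt_irrefl (v x) (hx hx0)
  · intro γ _ γ' _ hlt x hx hx0
    exact lt_of_lt_of_le hlt (show γ' ≤ v x from hx hx0)

end ValuationIdeals

/-- **Theorem 1 of the paper for rank 2.**  `R` a noetherian local domain, `ν` a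
valuation of its fraction field with values in `A × B ⊆ ℝ ×ₗ ℝ` (lex) dominating `R`,
`ν₂ = π ∘ ν` with center `p₂`, `(0) ≠ p₂ ≠ m_R`, `ν(R∖{0})` well ordered, `t₁ = ν(m_R)`,
`t₂ = ν₂(p₂)`, and for `φ₂ ∈ ν₂(R∖{0}) ∪ {0}` let `φ̃₂` be the least `ν`-value over `φ₂`.
Then there are `d ∈ ℕ` and `s : ℕ → ℕ` such that for all `y₂` and all `y₁ ≥ s y₂` the set
`{φ ∈ ν(m_R∖{0}) : 0 ≤ π φ < y₂·t₂, φ̃₂ ≤ φ < φ̃₂ + y₁·t₁ (φ₂ = π φ)}` is finite with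
cardinality at most `d·y₁^a·y₂^b`, `a = dim R/p₂`, `b = dim R_{p₂}`. -/
theorem stmt7 (R : Type*) [CommRing R] [IsDomain R] [IsNoetherianRing R] [IsLocalRing R]
    (K : Type*) [Field K] [Algebra R K] [IsFractionRing R K]
    (A B : AddSubgroup ℝ)
    (ν : K → ℝ ×ₗ ℝ)
    (hval : ∀ x : K, x ≠ 0 → (ofLex (ν x)).1 ∈ A ∧ (ofLex (ν x)).2 ∈ B)
    (hmul : ∀ x y : K, x ≠ 0 → y ≠ 0 → ν (x * y) = ν x + ν y)
    (hadd : ∀ x y : K, x ≠ 0 → y ≠ 0 → x + y ≠ 0 → min (ν x) (ν y) ≤ ν (x + y))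
    (hnonneg : ∀ x : R, x ≠ 0 → 0 ≤ ν (algebraMap R K x))
    (hdom : ∀ x : R, x ∈ IsLocalRing.maximalIdeal R → x ≠ 0 → 0 < ν (algebraMap R K x))
    (p₂ : Ideal R) [p₂.IsPrime]
    (hp₂ : ∀ x : R, x ∈ p₂ ↔ (x = 0 ∨ 0 < (ofLex (ν (algebraMap R K x))).1))
    (hp₂ne : p₂ ≠ ⊥) (hp₂nem : p₂ ≠ IsLocalRing.maximalIdeal R)
    (hWF : Set.IsWF {γ : ℝ ×ₗ ℝ | ∃ x : R, x ≠ 0 ∧ ν (algebraMap R K x) = γ})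
    (t₁ : ℝ ×ₗ ℝ)
    (ht₁ : IsLeast {γ : ℝ ×ₗ ℝ | ∃ x : R, x ∈ IsLocalRing.maximalIdeal R ∧ x ≠ 0 ∧
      ν (algebraMap R K x) = γ} t₁)
    (t₂ : ℝ)
    (ht₂ : IsLeast {r : ℝ | ∃ x : R, x ∈ p₂ ∧ x ≠ 0 ∧ (ofLex (ν (algebraMap R K x))).1 = r} t₂)
    (tilde : ℝ → ℝ ×ₗ ℝ)
    (htilde : ∀ φ₂ : ℝ, (φ₂ = 0 ∨ ∃ x : R, x ≠ 0 ∧ (ofLex (ν (algebraMap R K x))).1 = φ₂) →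
      IsLeast {γ : ℝ ×ₗ ℝ | ∃ x : R, x ≠ 0 ∧ (ofLex (ν (algebraMap R K x))).1 = φ₂ ∧
        ν (algebraMap R K x) = γ} (tilde φ₂))
    (a b : ℕ) (ha : ringKrullDim (R ⧸ p₂) = a)
    (hb : ringKrullDim (Localization p₂.primeCompl) = b) :
    ∃ d : ℕ, ∃ s : ℕ → ℕ, ∀ y₂ y₁ : ℕ, s y₂ ≤ y₁ →
      {γ : ℝ ×ₗ ℝ | (∃ x : R, x ∈ IsLocalRing.maximalIdeal R ∧ x ≠ 0 ∧
          ν (algebraMap R K x) = γ) ∧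
        0 ≤ (ofLex γ).1 ∧ (ofLex γ).1 < (y₂ : ℝ) * t₂ ∧
        tilde ((ofLex γ).1) ≤ γ ∧ γ < tilde ((ofLex γ).1) + y₁ • t₁}.Finite ∧
      {γ : ℝ ×ₗ ℝ | (∃ x : R, x ∈ IsLocalRing.maximalIdeal R ∧ x ≠ 0 ∧
          ν (algebraMap R K x) = γ) ∧
        0 ≤ (ofLex γ).1 ∧ (ofLex γ).1 < (y₂ : ℝ) * t₂ ∧
        tilde ((ofLex γ).1) ≤ γ ∧ γ < tilde ((ofLex γ).1) + y₁ • t₁}.ncard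
        ≤ d * y₁ ^ a * y₂ ^ b := by

  classical
  set v : R → ℝ ×ₗ ℝ := fun x ↦ ν (algebraMap R K x) with hvdef
  set w : R → ℝ := fun x ↦ (ofLex (v x)).1 with hwdef
  have hinj : ∀ x : R, x ≠ 0 → algebraMap R K x ≠ 0 := fun x hx ↦ by
    rwa [Ne, FaithfulSMul.algebraMap_eq_zero_iff]
  have hv : IsNonnegValuation v := by
    refine ⟨hnonneg, fun x y hx hy ↦ ?_, fun x y hx hy hxy ↦ ?_⟩
    · rw [hvdef]
      simp only [map_mul]
      exact hmul _ _ (hinj x hx) (hinj y hy)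
    · have := hadd _ _ (hinj x hx) (hinj y hy) (by rw [← map_add]; exact hinj _ hxy)
      rwa [← map_add] at this
  have hmono : ∀ γ γ' : ℝ ×ₗ ℝ, γ ≤ γ' → (ofLex γ).1 ≤ (ofLex γ').1 :=
    fun γ γ' h ↦ Prod.Lex.monotone_fst _ _ h
  have hlt : ∀ γ γ' : ℝ ×ₗ ℝ, (ofLex γ).1 < (ofLex γ').1 → γ < γ' := fun γ γ' h ↦
    lt_of_not_ge fun h' ↦ (hmono _ _ h').not_gt h
  have hw : IsNonnegValuation w := by
    refine ⟨fun x hx ↦ hmono _ _ (hv.nonneg x hx), fun x y hx hy ↦ ?_, fun x y hx hy hxy ↦ ?_⟩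
    · simp only [hwdef, hv.map_mul x y hx hy, ofLex_add, Prod.fst_add]
    · have h := hmono _ _ (hv.map_add x y hx hy hxy)
      rcases min_choice (v x) (v y) with e | e <;> rw [e] at h
      · exact (min_le_left _ _).trans h
      · exact (min_le_right _ _).trans h
  have hwp : ∀ x, x ∉ p₂ → w x = 0 := fun x hx ↦ by
    rw [hp₂, not_or, not_lt] at hx
    exact le_antisymm hx.2 (hw.nonneg x hx.1)
  have hpw : ∀ x ∈ p₂, x ≠ 0 → 0 < w x := fun x hx hx0 ↦ ((hp₂ x).mp hx).resolve_left hx0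
  let P : ℝ → Ideal R := fun φ ↦ hw.ideal (UpperSet.Ici φ)
  let Q : ℝ → Ideal R := fun φ ↦ hw.ideal (UpperSet.Ioi φ)
  have hQP : ∀ φ, Q φ ≤ P φ := fun φ x hx hx0 ↦ (show φ < w x from hx hx0).le
  let Rp := Localization.AtPrime p₂
  let E : Ideal R → Ideal Rp := Ideal.map (algebraMap R Rp)
  have hE : ∀ {I J : Ideal R}, I ≤ J → E I ≤ E J := fun h ↦ Ideal.map_mono h
  obtain ⟨D, hD⟩ := IsLocalRing.exists_length_quotient_maximalIdeal_pow_le (R := Rp) b hb.le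
  obtain ⟨e, he⟩ := IsLocalRing.exists_length_quotient_sup_smul_top_le p₂ hp₂nem a ha.le
  have hlenpow : ∀ k : ℕ, Module.length Rp (Rp ⧸ E (p₂ ^ k)) ≤ (D * k ^ b : ℕ) := fun k ↦ by
    have : E (p₂ ^ k) = IsLocalRing.maximalIdeal Rp ^ k := by
      rw [← Localization.AtPrime.map_eq_maximalIdeal]
      exact Ideal.map_pow _ _ _
    rw [this]
    exact hD k
  have hpk : ∀ k : ℕ, p₂ ^ k ≤ P (k * t₂) := fun k ↦ by
    have := hw.pow_le_ideal p₂ t₂ (fun x hx hx0 ↦ ht₂.2 ⟨x, hx, hx0, rfl⟩) k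
    rwa [nsmul_eq_mul] at this
  have hpkQ : ∀ (k : ℕ) (φ : ℝ), φ < k * t₂ → p₂ ^ k ≤ Q φ := fun k φ h x hx hx0 ↦
    h.trans_le (show k * t₂ ≤ w x from hpk k hx hx0)
  let lam : Ideal R → ℕ∞ := fun I ↦ Module.length Rp (Rp ⧸ E I)
  let rk : ℝ → ℕ := fun φ ↦ (lam (Q φ)).toNat - (lam (P φ)).toNat
  have hrk : ∀ (k : ℕ) (φ : ℝ), φ < k * t₂ → lam (P φ) ≠ ⊤ ∧ lam (Q φ) = lam (P φ) + rk φ := by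
    intro k φ h
    have hQtop : lam (Q φ) ≠ ⊤ := ne_top_of_le_ne_top (ENat.natCast_ne_top _)
      ((Module.length_quotient_anti (hE (hpkQ k φ h))).trans (hlenpow k))
    have hle : lam (P φ) ≤ lam (Q φ) := Module.length_quotient_anti (hE (hQP φ))
    have hPtop : lam (P φ) ≠ ⊤ := ne_top_of_le_ne_top hQtop hle
    refine ⟨hPtop, ?_⟩
    obtain ⟨m, hm⟩ := ENat.ne_top_iff_exists.mp hPtop
    obtain ⟨m', hm'⟩ := ENat.ne_top_iff_exists.mp hQtop
    simp only [rk]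
    rw [← hm, ← hm'] at hle ⊢
    have : m ≤ m' := by exact_mod_cast hle
    simp only [ENat.toNat_natCast]
    norm_cast
    omega
  have hsum : ∀ (k : ℕ) (T : Finset ℝ), (∀ φ ∈ T, φ < k * t₂) → ∑ φ ∈ T, rk φ ≤ D * k ^ b := by
    intro k T hT
    have h := Module.sum_le_length_quotient (fun φ ↦ E (P φ)) (fun φ ↦ E (Q φ))
      (fun φ ↦ (rk φ : ℕ∞)) T (fun φ hφ ↦ (hrk k φ (hT φ hφ)).2.ge)
      (fun φ _ φ' _ hlt ↦ hE fun x hx hx0 ↦ lt_of_lt_of_le hlt (show φ' ≤ w x from hx hx0))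
      (E (p₂ ^ k)) (fun φ hφ ↦ hE (hpkQ k φ (hT φ hφ)))
    have h' := h.trans (hlenpow k)
    exact_mod_cast h'
  let V : ℕ → Set ℝ := fun k ↦ {φ | φ < k * t₂ ∧ ∃ x : R, x ≠ 0 ∧ w x = φ}
  have hgen : ∀ k, ∀ φ ∈ V k, ∃ u : Fin (rk φ) → R, (∀ i, u i ∈ P φ) ∧ ∃ s ∉ p₂,
      ∀ x ∈ P φ, s * x ∈ Q φ ⊔ Ideal.span (Set.range u) := fun k φ hφ ↦
    Ideal.exists_fin_smul_mem_sup_span p₂ (Q φ) (P φ) (hQP φ) (rk φ) (hrk k φ hφ.1).1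
      (hrk k φ hφ.1).2.le
  have hrkpos : ∀ k, ∀ φ ∈ V k, 1 ≤ rk φ := by
    intro k φ hφ
    obtain ⟨u, hu, s, hs, h⟩ := hgen k φ hφ
    obtain ⟨-, x, hx0, hx⟩ := hφ
    by_contra hlt1
    have h0 : rk φ = 0 := by omega
    have hempty : IsEmpty (Fin (rk φ)) := by rw [h0]; infer_instance
    have hxP : x ∈ P φ := fun _ ↦ hx.ge
    have := h x hxP
    rw [Set.range_eq_empty, Ideal.span_empty, sup_bot_eq] at this
    have hs0 : s ≠ 0 := fun h ↦ hs (h ▸ p₂.zero_mem)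
    have h1 : φ < w (s * x) := this (mul_ne_zero hs0 hx0)
    rw [hw.map_mul s x hs0 hx0, hwp s hs, zero_add, hx] at h1
    exact h1.false
  have hVfin : ∀ k, (V k).Finite := fun k ↦
    (Set.finite_and_ncard_le_of_forall_finset (V k) (D * k ^ b) fun T hT ↦ by
      refine le_trans ?_ (hsum k T fun φ hφ ↦ (hT hφ).1)
      rw [Finset.card_eq_sum_ones]
      exact Finset.sum_le_sum fun φ hφ ↦ hrkpos k φ (hT hφ)).1
  let G : ℝ → ℕ → Set (ℝ ×ₗ ℝ) := fun φ n ↦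
    {γ | (∃ x : R, x ≠ 0 ∧ v x = γ) ∧ (ofLex γ).1 = φ ∧ γ < tilde φ + n • t₁}
  have hG : ∀ k, ∀ φ ∈ V k, ∃ n₀ : ℕ, ∀ n ≥ n₀,
      (G φ n).Finite ∧ (G φ n).ncard ≤ (rk φ * e + 1) * n ^ a := by
    intro k φ hφ
    obtain ⟨u, hu, s, hs, h⟩ := hgen k φ hφ
    have htl := htilde φ (Or.inr hφ.2)
    have htP : ∀ x ∈ P φ, x ≠ 0 → tilde φ ≤ v x := by
      intro x hx hx0
      rcases (show φ ≤ w x from hx hx0).eq_or_lt with heq | hlt'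
      · exact htl.2 ⟨x, hx0, heq.symm, rfl⟩
      · obtain ⟨y, hy0, hy, hyt⟩ := htl.1
        rw [← hyt]
        refine (hlt _ _ ?_).le
        rw [hy]
        exact hlt'
    obtain ⟨n₀, hn₀⟩ := he (P φ) ((Q φ).submoduleOf (P φ)) (fun c hc x hcx ↦ by
        have hc0 := left_ne_zero_of_mul hcx
        have hx0 := right_ne_zero_of_mul hcx
        change φ < w (c * (x : R))
        rw [hw.map_mul c x hc0 hx0]
        exact lt_add_of_pos_of_le (hpw c hc hc0) (x.2 hx0)) (rk φ) (fun i ↦ ⟨u i, hu i⟩) s hs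
      (fun x ↦ by
        obtain ⟨y, hy, z, hz, hyz⟩ := Submodule.mem_sup.mp (h x x.2)
        have hzP : Ideal.span (Set.range u) ≤ P φ := by
          rw [Ideal.span_le]
          rintro _ ⟨i, rfl⟩
          exact hu i
        refine Submodule.mem_sup.mpr ⟨⟨y, hQP φ hy⟩, hy, ⟨z, hzP hz⟩, ?_, Subtype.ext hyz⟩
        have hmap : (Submodule.span R (Set.range fun i ↦ (⟨u i, hu i⟩ : P φ))).map
            (P φ).subtype = Ideal.span (Set.range u) := by
          rw [Submodule.map_span, ← Set.range_comp]
          rfl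
        rw [← hmap] at hz
        obtain ⟨z', hz', rfl⟩ := hz
        exact hz')
    refine ⟨n₀, fun n hn ↦ hv.finite_ncard_le_of_length_le (P φ) _ _ (hn₀ n hn) (G φ n) ?_ ?_⟩
    · rintro γ ⟨⟨x, hx0, rfl⟩, hx, -⟩
      exact ⟨x, fun _ ↦ hx.ge, hx0, rfl⟩
    · rintro γ ⟨-, hγφ, hγ⟩
      refine sup_le ?_ ?_
      · intro x hx hx0
        refine hlt _ _ ?_
        rw [hγφ]
        exact hx hx0
      · rw [Submodule.smul_le]
        intro c hc x _ hcx
        have hc0 := left_ne_zero_of_mul hcx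
        have hx0 := right_ne_zero_of_mul hcx
        have hcn : n • t₁ ≤ v c := hv.pow_le_ideal (IsLocalRing.maximalIdeal R) t₁
          (fun x hx hx0 ↦ ht₁.2 ⟨x, hx, hx0, rfl⟩) n hc hc0
        change γ < v (c * (x : R))
        rw [hv.map_mul c x hc0 hx0, add_comm]
        exact hγ.trans_le (add_le_add (htP x x.2 hx0) hcn)
  choose! n₀ hn₀ using fun (φ : ℝ) (h : ∃ k, φ ∈ V k) ↦ hG h.choose φ h.choose_spec
  refine ⟨(e + 1) * D, fun k ↦ (hVfin k).toFinset.sup n₀, fun k n hkn ↦ ?_⟩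
  have hGn : ∀ φ ∈ (hVfin k).toFinset,
      (G φ n).Finite ∧ (G φ n).ncard ≤ (rk φ * e + 1) * n ^ a := fun φ hφ ↦
    hn₀ φ ⟨k, (hVfin k).mem_toFinset.mp hφ⟩ n ((Finset.le_sup hφ).trans hkn)
  have hfinU : (⋃ φ ∈ (hVfin k).toFinset, G φ n).Finite :=
    (hVfin k).toFinset.finite_toSet.biUnion fun φ hφ ↦ (hGn φ hφ).1
  have hsub : {γ : ℝ ×ₗ ℝ | (∃ x : R, x ∈ IsLocalRing.maximalIdeal R ∧ x ≠ 0 ∧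
          ν (algebraMap R K x) = γ) ∧
        0 ≤ (ofLex γ).1 ∧ (ofLex γ).1 < (k : ℝ) * t₂ ∧
        tilde ((ofLex γ).1) ≤ γ ∧ γ < tilde ((ofLex γ).1) + n • t₁} ⊆
      ⋃ φ ∈ (hVfin k).toFinset, G φ n := by
    rintro γ ⟨⟨x, -, hx0, hx⟩, -, hγk, -, hγ⟩
    refine Set.mem_biUnion (x := (ofLex γ).1) ?_ ⟨⟨x, hx0, hx⟩, rfl, hγ⟩
    rw [SetLike.mem_coe, (hVfin k).mem_toFinset]
    exact ⟨hγk, x, hx0, by rw [← hx]⟩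
  refine ⟨hfinU.subset hsub, (Set.ncard_le_ncard hsub hfinU).trans ?_⟩
  calc (⋃ φ ∈ (hVfin k).toFinset, G φ n).ncard
      ≤ ∑ φ ∈ (hVfin k).toFinset, (G φ n).ncard := Finset.set_ncard_biUnion_le _ _
    _ ≤ ∑ φ ∈ (hVfin k).toFinset, rk φ * ((e + 1) * n ^ a) := by
        refine Finset.sum_le_sum fun φ hφ ↦ (hGn φ hφ).2.trans ?_
        rw [← mul_assoc, mul_add_one (rk φ)]
        gcongr
        exact hrkpos k φ ((hVfin k).mem_toFinset.mp hφ)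
    _ = (∑ φ ∈ (hVfin k).toFinset, rk φ) * ((e + 1) * n ^ a) := by rw [Finset.sum_mul]
    _ ≤ (D * k ^ b) * ((e + 1) * n ^ a) := by
        gcongr
        exact hsum k _ fun φ hφ ↦ ((hVfin k).mem_toFinset.mp hφ).1
    _ = _ := by ring
end

section
/- Fix an integer r ≥ 1, let S = {(2^m + j) + α/2^{(m+1)r} : m, j, α ∈ ℕ, 0 ≤ j < 2^m, 0 ≤ α < 2^{(m+1)r}} ⊆ ℚ, and for a positive integer y let f(y) = Σ_{n=1}^{y−1} n^r. Then for every integer y ≥ 2, the set S ∩ [0, y) is finite and f(y) < #(S ∩ [0, y)) ≤ 2^r·f(y). -/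
/-- The semigroup `S` of Example 3, for a given `r`. -/
def exS (r : ℕ) : Set ℚ :=
  {q : ℚ | ∃ m j α : ℕ, j < 2 ^ m ∧ α < 2 ^ ((m + 1) * r) ∧
    q = (2 ^ m + j : ℚ) + (α : ℚ) / 2 ^ ((m + 1) * r)}

/-- `f(y) = Σ_{n=1}^{y-1} n^r`. -/
def exf (r y : ℕ) : ℕ := ∑ n ∈ Finset.Ico 1 y, n ^ r

/-- The number of points of `exS r` in `[n, n + 1)`, for `n ≥ 1`. -/
def exCount (r n : ℕ) : ℕ := 2 ^ ((Nat.log 2 n + 1) * r)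

theorem exCount_pos (r n : ℕ) : 0 < exCount r n := by
  unfold exCount; positivity

theorem pow_lt_exCount {r : ℕ} (hr : 1 ≤ r) (n : ℕ) : n ^ r < exCount r n := by
  rw [exCount, pow_mul]
  exact Nat.pow_lt_pow_left (Nat.lt_pow_succ_log_self one_lt_two n) (by omega)

theorem exCount_le (r : ℕ) {n : ℕ} (hn : n ≠ 0) : exCount r n ≤ 2 ^ r * n ^ r := by
  rw [exCount, pow_mul, ← mul_pow, pow_succ']
  exact Nat.pow_le_pow_left (Nat.mul_le_mul_left 2 (Nat.pow_log_le_self 2 hn)) r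

theorem mem_exS_iff {r : ℕ} {q : ℚ} :
    q ∈ exS r ↔ ∃ n α : ℕ, 1 ≤ n ∧ α < exCount r n ∧ q = n + (α : ℚ) / exCount r n := by
  constructor
  · rintro ⟨m, j, α, hj, hα, rfl⟩
    have hlog : Nat.log 2 (2 ^ m + j) = m :=
      Nat.log_eq_of_pow_le_of_lt_pow (by omega) (by rw [pow_succ]; omega)
    refine ⟨2 ^ m + j, α, ?_, ?_, ?_⟩
    · have := Nat.one_le_two_pow (n := m)
      omega
    · rwa [exCount, hlog]
    · rw [exCount, hlog]
      push_cast
      rfl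
  · rintro ⟨n, α, hn, hα, rfl⟩
    have hle := Nat.pow_log_le_self 2 (x := n) (by omega)
    have hlt := Nat.lt_pow_succ_log_self one_lt_two n
    refine ⟨Nat.log 2 n, n - 2 ^ Nat.log 2 n, α, ?_, hα, ?_⟩
    · rw [Nat.succ_eq_add_one, pow_succ] at hlt
      omega
    · rw [exCount]
      push_cast [Nat.cast_sub hle]
      ring

theorem floor_add_div_eq (n : ℕ) {α d : ℕ} (h : α < d) : ⌊(n : ℚ) + (α : ℚ) / d⌋₊ = n := by
  have hd : (0 : ℚ) < d := by exact_mod_cast (Nat.zero_le α).trans_lt h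
  rw [Nat.floor_eq_iff (by positivity)]
  have h1 : (α : ℚ) / d < 1 := (div_lt_one hd).2 (by exact_mod_cast h)
  exact ⟨le_add_of_nonneg_right (by positivity), by linarith⟩

/-- The pairs `(n, α)` that index the points of `exS r` below `y`. -/
def exIndex (r y : ℕ) : Finset (Σ _ : ℕ, ℕ) :=
  (Finset.Ico 1 y).sigma fun n => Finset.range (exCount r n)

theorem injOn_exIndex (r y : ℕ) :
    Set.InjOn (fun p : Σ _ : ℕ, ℕ => (p.1 : ℚ) + (p.2 : ℚ) / exCount r p.1)
      (exIndex r y) := by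
  rintro ⟨n, α⟩ hp ⟨k, β⟩ hq h
  simp only [exIndex, Finset.mem_coe, Finset.mem_sigma, Finset.mem_range] at hp hq h
  have hnk := congrArg Nat.floor h
  rw [floor_add_div_eq n hp.2, floor_add_div_eq k hq.2] at hnk
  subst hnk
  have hd : (exCount r n : ℚ) ≠ 0 := by exact_mod_cast (exCount_pos r n).ne'
  have hαβ : α = β := by exact_mod_cast (div_left_inj' hd).1 (add_left_cancel h)
  rw [hαβ]

theorem exS_inter_eq_image (r y : ℕ) :
    {q : ℚ | q ∈ exS r ∧ 0 ≤ q ∧ q < (y : ℚ)} =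
      (fun p : Σ _ : ℕ, ℕ => (p.1 : ℚ) + (p.2 : ℚ) / exCount r p.1) '' (exIndex r y) := by
  ext q
  simp only [Set.mem_ofPred_eq, mem_exS_iff, exIndex, Set.mem_image, Finset.mem_coe,
    Finset.mem_sigma, Finset.mem_Ico, Finset.mem_range]
  constructor
  · rintro ⟨⟨n, α, hn, hα, rfl⟩, -, hy⟩
    have hny : (n : ℚ) < y := lt_of_le_of_lt (le_add_of_nonneg_right (by positivity)) hy
    exact ⟨⟨n, α⟩, ⟨⟨hn, by exact_mod_cast hny⟩, hα⟩, rfl⟩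
  · rintro ⟨⟨n, α⟩, ⟨⟨hn, hny⟩, hα⟩, rfl⟩
    refine ⟨⟨n, α, hn, hα, rfl⟩, by positivity, ?_⟩
    rw [← Nat.floor_lt (by positivity), floor_add_div_eq n hα]
    exact hny

theorem ncard_exS_inter (r y : ℕ) :
    {q : ℚ | q ∈ exS r ∧ 0 ≤ q ∧ q < (y : ℚ)}.ncard =
      ∑ n ∈ Finset.Ico 1 y, exCount r n := by
  rw [exS_inter_eq_image, (injOn_exIndex r y).ncard_image, Set.ncard_coe_finset,
    exIndex, Finset.card_sigma]
  simp only [Finset.card_range]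

/-- For `r ≥ 1` and every integer `y ≥ 2`, the set `S ∩ [0, y)` is finite
and `f(y) < #(S ∩ [0, y)) ≤ 2^r·f(y)`. -/
theorem stmt10 (r : ℕ) (hr : 1 ≤ r) (y : ℕ) (hy : 2 ≤ y) :
    {q : ℚ | q ∈ exS r ∧ 0 ≤ q ∧ q < (y : ℚ)}.Finite ∧
    exf r y < {q : ℚ | q ∈ exS r ∧ 0 ≤ q ∧ q < (y : ℚ)}.ncard ∧
    {q : ℚ | q ∈ exS r ∧ 0 ≤ q ∧ q < (y : ℚ)}.ncard ≤ 2 ^ r * exf r y := by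
  rw [ncard_exS_inter, exf, Finset.mul_sum]
  refine ⟨?_, ?_, ?_⟩
  · rw [exS_inter_eq_image]
    exact (exIndex r y).finite_toSet.image _
  · exact Finset.sum_lt_sum_of_nonempty (Finset.nonempty_Ico.2 (by omega))
      fun n _ => pow_lt_exCount hr n
  · refine Finset.sum_le_sum fun n hn => exCount_le r ?_
    have := (Finset.mem_Ico.1 hn).1
    omega
end
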